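/- arXiv:1512.00135 — 5 statements merged into one kernel-verified Lean document; each statement's English description precedes it below -/
import Mathlib

section
/- For every M > 0, there exist independent, identically distributed ℤ-valued random variables X and Y with finite Shannon entropy (indeed with finite support) such that H(X+Y) − H(X−Y) > M. -/
open MeasureTheory ProbabilityTheory

/-- Shannon entropy (in nats) of a discrete random variable `X` on the
probability space `(Ω, P)`: `H(X) = -∑ₛ P(X = s) log P(X = s)`. -/
noncomputable def shEnt {Ω S : Type*} [MeasurableSpace Ω] (P : Measure Ω) (X : Ω → S) : ℝ :=
  ∑' s : S, Real.negMulLog (P (X ⁻¹' {s})).toReal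

/-- The number of points at which `g` takes the same value as at `ω`. -/
def fiberCard {Ω S : Type*} [Fintype Ω] [DecidableEq S] (g : Ω → S) (ω : Ω) : ℕ :=
  (Finset.univ.filter fun η => g η = g ω).card

/-- The average of `log (fiberCard g ω)` over a finite type. For uniform `ω` this is the
conditional entropy of `ω` given `g ω`. -/
noncomputable def meanLogFiber {Ω S : Type*} [Fintype Ω] [DecidableEq S] (g : Ω → S) : ℝ :=
  (∑ ω, Real.log (fiberCard g ω)) / Fintype.card Ω

section Fiber

variable {Ω Ω₁ Ω₂ S S₁ S₂ : Type*} [Fintype Ω] [Fintype Ω₁] [Fintype Ω₂]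
  [DecidableEq S] [DecidableEq S₁] [DecidableEq S₂]

theorem fiberCard_pos (g : Ω → S) (ω : Ω) : 0 < fiberCard g ω :=
  Finset.card_pos.2 ⟨ω, by simp⟩

theorem fiberCard_eq_mul (e : Ω ≃ Ω₁ × Ω₂) (u : Ω → S) (g : Ω₁ → S₁) (h : Ω₂ → S₂)
    (hu : ∀ x y, u x = u y ↔ g (e x).1 = g (e y).1 ∧ h (e x).2 = h (e y).2) (x : Ω) :
    fiberCard u x = fiberCard g (e x).1 * fiberCard h (e x).2 := by
  unfold fiberCard
  rw [← Finset.card_product]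
  refine Finset.card_equiv e fun y => ?_
  simp [hu]

theorem meanLogFiber_eq_add [Nonempty Ω₁] [Nonempty Ω₂] (e : Ω ≃ Ω₁ × Ω₂) (u : Ω → S)
    (g : Ω₁ → S₁) (h : Ω₂ → S₂)
    (hu : ∀ x y, u x = u y ↔ g (e x).1 = g (e y).1 ∧ h (e x).2 = h (e y).2) :
    meanLogFiber u = meanLogFiber g + meanLogFiber h := by
  have hlog : ∀ x, Real.log (fiberCard u x) =
      Real.log (fiberCard g (e x).1) + Real.log (fiberCard h (e x).2) := fun x => by
    rw [fiberCard_eq_mul e u g h hu, Nat.cast_mul, Real.log_mul] <;>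
      exact Nat.cast_ne_zero.2 (fiberCard_pos _ _).ne'
  have h₁ : (Fintype.card Ω₁ : ℝ) ≠ 0 := Nat.cast_ne_zero.2 Fintype.card_ne_zero
  have h₂ : (Fintype.card Ω₂ : ℝ) ≠ 0 := Nat.cast_ne_zero.2 Fintype.card_ne_zero
  unfold meanLogFiber
  simp_rw [hlog]
  rw [e.sum_comp fun p => Real.log (fiberCard g p.1) + Real.log (fiberCard h p.2),
    Fintype.card_congr e, Fintype.card_prod, Fintype.sum_prod_type]
  simp only [Finset.sum_add_distrib, Finset.sum_const, Finset.card_univ, nsmul_eq_mul,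
    ← Finset.mul_sum, Nat.cast_mul]
  field_simp

/-- The entropy of a function on a finite type carrying the uniform measure. -/
theorem shEnt_eq_log_card_sub_meanLogFiber [Nonempty Ω] [MeasurableSpace Ω]
    [MeasurableSingletonClass Ω] (P : Measure Ω) [IsFiniteMeasure P]
    (hP : ∀ ω, P.real {ω} = (Fintype.card Ω : ℝ)⁻¹) (g : Ω → S) :
    shEnt P g = Real.log (Fintype.card Ω) - meanLogFiber g := by
  have hn : (Fintype.card Ω : ℝ) ≠ 0 := Nat.cast_ne_zero.2 Fintype.card_ne_zero
  have hfib : ∀ s, (P (g ⁻¹' {s})).toReal =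
      ((Finset.univ.filter fun η => g η = s).card : ℝ) * (Fintype.card Ω : ℝ)⁻¹ := fun s => by
    have hs : g ⁻¹' {s} = ((Finset.univ.filter fun η => g η = s : Finset Ω) : Set Ω) := by
      ext; simp
    rw [hs, ← measureReal_def, ← sum_measureReal_singleton]
    simp [hP]
  have hsum : shEnt P g =
      ∑ s ∈ Finset.univ.image g, Real.negMulLog (P (g ⁻¹' {s})).toReal := by
    refine tsum_eq_sum fun s hs => ?_
    have : g ⁻¹' {s} = ∅ := by
      ext ω
      simp only [Finset.mem_image, Finset.mem_univ, true_and, not_exists] at hs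
      simpa using hs ω
    simp [this]
  have hterm : ∀ s ∈ Finset.univ.image g, Real.negMulLog (P (g ⁻¹' {s})).toReal =
      ∑ ω with g ω = s, (Real.log (Fintype.card Ω) - Real.log (fiberCard g ω)) *
        (Fintype.card Ω : ℝ)⁻¹ := fun s hs => by
    obtain ⟨ω₀, -, rfl⟩ := Finset.mem_image.1 hs
    have hc : (fiberCard g ω₀ : ℝ) ≠ 0 := Nat.cast_ne_zero.2 (fiberCard_pos g ω₀).ne'
    have hconst : ∀ ω ∈ Finset.univ.filter fun ω => g ω = g ω₀,
        (Real.log (Fintype.card Ω) - Real.log (fiberCard g ω)) * (Fintype.card Ω : ℝ)⁻¹ =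
        (Real.log (Fintype.card Ω) - Real.log (fiberCard g ω₀)) * (Fintype.card Ω : ℝ)⁻¹ :=
      fun ω hω => by simp [fiberCard, (Finset.mem_filter.1 hω).2]
    rw [Finset.sum_congr rfl hconst, Finset.sum_const, nsmul_eq_mul, hfib]
    change Real.negMulLog ((fiberCard g ω₀ : ℝ) * _) = (fiberCard g ω₀ : ℝ) * _
    rw [Real.negMulLog, Real.log_mul hc (inv_ne_zero hn), Real.log_inv]
    ring
  rw [hsum, Finset.sum_congr rfl hterm,
    Finset.sum_fiberwise_of_maps_to fun ω _ => Finset.mem_image_of_mem g (Finset.mem_univ ω),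
    ← Finset.sum_mul, Finset.sum_sub_distrib]
  simp only [Finset.sum_const, Finset.card_univ, nsmul_eq_mul, meanLogFiber]
  field_simp

end Fiber

/-- The sum of two values of `f`, as a function on pairs of indices. -/
def pairSum {ι : Type*} (f : ι → ℤ) (p : ι × ι) : ℤ := f p.1 + f p.2

/-- The difference of two values of `f`, as a function on pairs of indices. -/
def pairDiff {ι : Type*} (f : ι → ℤ) (p : ι × ι) : ℤ := f p.1 - f p.2

/-- The excess `H(X + Y) - H(X - Y)` for independent `X`, `Y` distributed as `f` of a uniform
index. -/
noncomputable def entropyExcess {ι : Type*} [Fintype ι] (f : ι → ℤ) : ℝ :=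
  meanLogFiber (pairDiff f) - meanLogFiber (pairSum f)

theorem add_mul_eq_add_mul_iff {N a a' : ℤ} (ha : 2 * |a| < N) (ha' : 2 * |a'| < N) (b b' : ℤ) :
    a + N * b = a' + N * b' ↔ a = a' ∧ b = b' := by
  refine ⟨fun h => ?_, by rintro ⟨rfl, rfl⟩; rfl⟩
  have hlt : |a - a'| < N := (abs_sub a a').trans_lt (by linarith)
  have hz : a - a' = 0 := Int.eq_zero_of_abs_lt_dvd ⟨b' - b, by linarith⟩ hlt
  have hN : N ≠ 0 := by have := abs_nonneg a; omega
  refine ⟨sub_eq_zero.1 hz, mul_left_cancel₀ hN (by linarith)⟩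

theorem entropyExcess_add_mul {ι κ : Type*} [Fintype ι] [Fintype κ] [Nonempty ι] [Nonempty κ]
    (f : ι → ℤ) (g : κ → ℤ) (N : ℤ) (hf : ∀ i, 4 * |f i| < N) :
    entropyExcess (fun p : ι × κ => f p.1 + N * g p.2) = entropyExcess f + entropyExcess g := by
  have hsum : ∀ p : ι × ι, 2 * |pairSum f p| < N := fun p => by
    have := abs_add_le (f p.1) (f p.2)
    have := hf p.1
    have := hf p.2
    unfold pairSum
    linarith
  have hdiff : ∀ p : ι × ι, 2 * |pairDiff f p| < N := fun p => by
    have := abs_sub (f p.1) (f p.2)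
    have := hf p.1
    have := hf p.2
    unfold pairDiff
    linarith
  have h₁ := meanLogFiber_eq_add (Equiv.prodProdProdComm ι κ ι κ)
    (pairSum fun p : ι × κ => f p.1 + N * g p.2) (pairSum f) (pairSum g) fun x y => by
      rw [← add_mul_eq_add_mul_iff (hsum _) (hsum _)]
      simp only [pairSum, Equiv.prodProdProdComm_apply]
      ring_nf
  have h₂ := meanLogFiber_eq_add (Equiv.prodProdProdComm ι κ ι κ)
    (pairDiff fun p : ι × κ => f p.1 + N * g p.2) (pairDiff f) (pairDiff g) fun x y => by
      rw [← add_mul_eq_add_mul_iff (hdiff _) (hdiff _)]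
      simp only [pairDiff, Equiv.prodProdProdComm_apply]
      ring_nf
  rw [entropyExcess, h₁, h₂, entropyExcess, entropyExcess]
  ring

/-- Conway's set, which has more sums than differences. -/
def conwaySet : Fin 8 → ℤ := ![0, 2, 3, 4, 7, 11, 12, 14]

theorem entropyExcess_conwaySet_pos : 0 < entropyExcess conwaySet := by
  have hprod : ∏ p, fiberCard (pairSum conwaySet) p < ∏ p, fiberCard (pairDiff conwaySet) p := by
    decide +kernel
  have hlog : ∀ g : Fin 8 × Fin 8 → ℤ, meanLogFiber g =
      Real.log ((∏ p, fiberCard g p : ℕ) : ℝ) / Fintype.card (Fin 8 × Fin 8) := fun g => by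
    rw [meanLogFiber, Nat.cast_prod, Real.log_prod]
    exact fun p _ => Nat.cast_ne_zero.2 (fiberCard_pos g p).ne'
  rw [entropyExcess, sub_pos, hlog, hlog]
  have hpos : 0 < ∏ p, fiberCard (pairSum conwaySet) p :=
    Finset.prod_pos fun p _ => fiberCard_pos _ p
  have hcard : (0 : ℝ) < Fintype.card (Fin 8 × Fin 8) := Nat.cast_pos.2 Fintype.card_pos
  exact div_lt_div_of_pos_right
    (Real.log_lt_log (Nat.cast_pos.2 hpos) (Nat.cast_lt.2 hprod)) hcard

theorem exists_entropyExcess_ge_nsmul (k : ℕ) :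
    ∃ (ι : Type) (_ : Fintype ι) (_ : Nonempty ι) (f : ι → ℤ),
      k * entropyExcess conwaySet ≤ entropyExcess f := by
  induction k with
  | zero => exact ⟨Fin 8, inferInstance, inferInstance, conwaySet, by
      simpa using entropyExcess_conwaySet_pos.le⟩
  | succ k ih =>
    obtain ⟨ι, _, _, f, hf⟩ := ih
    refine ⟨Fin 8 × ι, inferInstance, inferInstance, fun p => conwaySet p.1 + 57 * f p.2, ?_⟩
    rw [entropyExcess_add_mul conwaySet f 57 (by decide)]
    push_cast
    linarith

/-- for every `M > 0` there exist i.i.d. `ℤ`-valued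
random variables `X, Y` with finite entropy (indeed finite support) such that
`H(X+Y) - H(X-Y) > M`. -/
theorem exists_iid_entropy_add_gt_entropy_sub (M : ℝ) (hM : 0 < M) :
    ∃ (Ω : Type) (_ : MeasurableSpace Ω) (P : Measure Ω) (X Y : Ω → ℤ),
      IsProbabilityMeasure P ∧ Measurable X ∧ Measurable Y ∧
      IndepFun X Y P ∧ IdentDistrib X Y P P ∧
      (Set.range X).Finite ∧
      Summable (fun z : ℤ => Real.negMulLog (P (X ⁻¹' {z})).toReal) ∧
      shEnt P (fun ω => X ω + Y ω) - shEnt P (fun ω => X ω - Y ω) > M := by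
  obtain ⟨k, hk⟩ := exists_lt_nsmul entropyExcess_conwaySet_pos M
  obtain ⟨ι, _, _, f, hf⟩ := exists_entropyExcess_ge_nsmul k
  let _ : MeasurableSpace ι := ⊤
  let μ : Measure ι := uniformOn Set.univ
  have hf_meas : Measurable f := measurable_from_top
  have hfin : (Set.range fun p : ι × ι => f p.1).Finite := Set.finite_range _
  have hμ : ∀ i, μ.real {i} = (Fintype.card ι : ℝ)⁻¹ := fun i => by
    simp [μ, measureReal_def, uniformOn_univ]
  have hP : ∀ p, (μ.prod μ).real {p} = (Fintype.card (ι × ι) : ℝ)⁻¹ := fun p => by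
    rw [← Prod.mk.eta (p := p), ← Set.singleton_prod_singleton, measureReal_prod_prod, hμ, hμ,
      Fintype.card_prod, Nat.cast_mul, mul_inv]
  refine ⟨ι × ι, inferInstance, μ.prod μ, fun p => f p.1, fun p => f p.2, inferInstance,
    hf_meas.comp measurable_fst, hf_meas.comp measurable_snd, indepFun_prod hf_meas hf_meas,
    ⟨(hf_meas.comp measurable_fst).aemeasurable, (hf_meas.comp measurable_snd).aemeasurable, ?_⟩,
    hfin, summable_of_hasFiniteSupport (hfin.subset fun z hz => ?_), ?_⟩
  · change Measure.map (f ∘ Prod.fst) _ = Measure.map (f ∘ Prod.snd) _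
    rw [← Measure.map_map hf_meas measurable_fst, ← Measure.map_map hf_meas measurable_snd,
      Measure.map_fst_prod, Measure.map_snd_prod]
  · by_contra hne
    have : (fun p : ι × ι => f p.1) ⁻¹' {z} = ∅ := by
      ext p
      simpa using fun h => hne ⟨p, h⟩
    exact hz (by simp [this])
  · rw [shEnt_eq_log_card_sub_meanLogFiber _ hP, shEnt_eq_log_card_sub_meanLogFiber _ hP]
    have : M < entropyExcess f := hk.trans_le (by simpa using hf)
    unfold entropyExcess pairSum pairDiff at this
    linarith
end

section
/- For every real number M, there exist independent, identically distributed ℤ-valued random variables X and Y with finite Shannon entropy (indeed with finite support) such that H(X+Y) − H(X−Y) = M. -/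
open MeasureTheory ProbabilityTheory

lemma sum_fst_mul_snd {α β R : Type*} [Fintype α] [Fintype β] [NonUnitalNonAssocSemiring R]
    (x : α → R) (y : β → R) : ∑ p : α × β, x p.1 * y p.2 = (∑ a, x a) * ∑ b, y b := by
  rw [Fintype.sum_prod_type, Finset.sum_mul_sum]

/-- Entropy of the image under `g` of the weights `w` on a finite type. -/
noncomputable def finEnt {Ω S : Type*} [Fintype Ω] [DecidableEq S] (w : Ω → ℝ) (g : Ω → S) : ℝ :=
  ∑ z ∈ Finset.univ.image g, Real.negMulLog (∑ i with g i = z, w i)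

section finEnt

variable {Ω Ω' S T : Type*} [Fintype Ω] [Fintype Ω'] [DecidableEq S] [DecidableEq T]

lemma finEnt_comp_of_injOn (w : Ω → ℝ) (g : Ω → S) {φ : S → T} (hφ : Set.InjOn φ (Set.range g)) :
    finEnt w (fun i => φ (g i)) = finEnt w g := by
  classical
  have himage : Finset.univ.image (fun i => φ (g i)) = (Finset.univ.image g).image φ := by
    rw [Finset.image_image]; rfl
  unfold finEnt
  rw [himage, Finset.sum_image (by simpa using hφ)]
  refine Finset.sum_congr rfl fun z hz => ?_
  obtain ⟨j, -, rfl⟩ := Finset.mem_image.1 hz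
  simp only [hφ.eq_iff (Set.mem_range_self _) (Set.mem_range_self j)]

lemma finEnt_comp_equiv (w : Ω → ℝ) (g : Ω → S) (e : Ω' ≃ Ω) :
    finEnt (fun i => w (e i)) (fun i => g (e i)) = finEnt w g := by
  classical
  unfold finEnt
  have himage : Finset.univ.image (fun i => g (e i)) = Finset.univ.image g := by
    ext z
    simp [e.surjective.exists]
  rw [himage]
  refine Finset.sum_congr rfl fun z _ => ?_
  congr 1
  simp only [Finset.sum_filter]
  exact e.sum_comp fun i => if g i = z then w i else 0

lemma sum_image_sum_fiber (w : Ω → ℝ) (g : Ω → S) :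
    ∑ z ∈ Finset.univ.image g, ∑ i with g i = z, w i = ∑ i, w i :=
  Finset.sum_fiberwise_of_maps_to (fun i _ => Finset.mem_image_of_mem g (Finset.mem_univ i)) w

lemma finEnt_prod {w : Ω → ℝ} {w' : Ω' → ℝ} (hw : ∑ i, w i = 1) (hw' : ∑ i, w' i = 1)
    (g : Ω → S) (g' : Ω' → T) :
    finEnt (fun p : Ω × Ω' => w p.1 * w' p.2) (fun p => (g p.1, g' p.2)) =
      finEnt w g + finEnt w' g' := by
  classical
  have himage : Finset.univ.image (fun p : Ω × Ω' => (g p.1, g' p.2)) =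
      Finset.univ.image g ×ˢ Finset.univ.image g' := by
    ext ⟨a, b⟩
    simp
  have hfiber (a : S) (b : T) : ∑ p : Ω × Ω' with (g p.1, g' p.2) = (a, b), w p.1 * w' p.2 =
      (∑ i with g i = a, w i) * ∑ i with g' i = b, w' i := by
    rw [Finset.sum_mul_sum, ← Finset.sum_product']
    congr 1
    ext p
    simp
  unfold finEnt
  rw [himage, Finset.sum_product]
  simp only [hfiber, Real.negMulLog_mul, Finset.sum_add_distrib, ← Finset.sum_mul,
    ← Finset.mul_sum, sum_image_sum_fiber, hw, hw', one_mul]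

lemma finEnt_natCast_div (c : Ω → ℕ) (g : Ω → S) {n : ℕ} (hn : n ≠ 0) (hc : ∑ i, c i = n) :
    finEnt (fun i => (c i : ℝ) / n) g = Real.log n -
      Real.log (∏ z ∈ Finset.univ.image g,
        (∑ i with g i = z, c i) ^ (∑ i with g i = z, c i) : ℕ) / n := by
  have hn' : (n : ℝ) ≠ 0 := by exact_mod_cast hn
  have hterm (k : ℕ) : Real.negMulLog ((k : ℝ) / n) =
      k * (Real.log n / n) - Real.log ((k ^ k : ℕ) : ℝ) / n := by
    rcases eq_or_ne k 0 with rfl | hk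
    · simp
    · rw [Real.negMulLog, Real.log_div (by exact_mod_cast hk) hn']
      push_cast
      rw [Real.log_pow]
      ring
  have hpow (k : ℕ) : ((k ^ k : ℕ) : ℝ) ≠ 0 := by
    rcases eq_or_ne k 0 with rfl | hk
    · simp
    · exact_mod_cast pow_ne_zero k hk
  have htotal : ∑ z ∈ Finset.univ.image g, ((∑ i with g i = z, c i : ℕ) : ℝ) = n := by
    rw [← hc]
    push_cast
    exact sum_image_sum_fiber (fun i => (c i : ℝ)) g
  unfold finEnt
  rw [Nat.cast_prod, Real.log_prod fun z _ => hpow _]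
  simp only [← Finset.sum_div, ← Nat.cast_sum, hterm, Finset.sum_sub_distrib]
  rw [← Finset.sum_mul, htotal]
  field_simp

lemma continuous_finEnt {w : ℝ → Ω → ℝ} (hw : ∀ i, Continuous fun t => w t i) (g : Ω → S) :
    Continuous fun t => finEnt (w t) g :=
  continuous_finsetSum _ fun _ _ =>
    Real.continuous_negMulLog.comp (continuous_finsetSum _ fun i _ => hw i)

lemma shEnt_eq_finEnt [MeasurableSpace Ω] [MeasurableSingletonClass Ω] (P : Measure Ω)
    [IsFiniteMeasure P] (g : Ω → S) : shEnt P g = finEnt (fun i => P.real {i}) g := by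
  classical
  have hfiber (z : S) : (P (g ⁻¹' {z})).toReal = ∑ i with g i = z, P.real {i} := by
    rw [sum_measureReal_singleton, measureReal_def]
    congr 2
    ext i
    simp
  unfold shEnt finEnt
  simp only [hfiber]
  refine tsum_eq_sum fun z hz => ?_
  rw [Finset.filter_eq_empty_iff.2 fun i _ hi =>
    hz (Finset.mem_image.2 ⟨i, Finset.mem_univ i, hi⟩)]
  simp

end finEnt

/-- `H(X + Y) - H(X - Y)` for independent `X`, `Y` distributed as the image under `f` of the
weights `w`. -/
noncomputable def entropyGap {ι : Type*} [Fintype ι] (w : ι → ℝ) (f : ι → ℤ) : ℝ :=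
  finEnt (fun p : ι × ι => w p.1 * w p.2) (fun p => f p.1 + f p.2) -
    finEnt (fun p : ι × ι => w p.1 * w p.2) (fun p => f p.1 - f p.2)

/-- `M` is the entropy gap of some finitely supported probability distribution on `ℤ`. -/
def IsEntropyGap (M : ℝ) : Prop :=
  ∃ (ι : Type) (_ : Fintype ι) (w : ι → ℝ) (f : ι → ℤ),
    (∀ i, 0 ≤ w i) ∧ ∑ i, w i = 1 ∧ entropyGap w f = M

lemma finEnt_add_mul {ι κ : Type*} [Fintype ι] [Fintype κ] {w : ι → ℝ} {w' : κ → ℝ}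
    (hw : ∑ i, w i = 1) (hw' : ∑ i, w' i = 1) (u : ι × ι → ℤ) (v : κ × κ → ℤ) {K N : ℤ}
    (hu : ∀ p, |u p| ≤ K) (hN : 2 * K < N) :
    finEnt (fun q : (ι × κ) × (ι × κ) => (w q.1.1 * w' q.1.2) * (w q.2.1 * w' q.2.2))
        (fun q => u (q.1.1, q.2.1) + N * v (q.1.2, q.2.2)) =
      finEnt (fun p : ι × ι => w p.1 * w p.2) u + finEnt (fun p : κ × κ => w' p.1 * w' p.2) v := by
  have hsq : ∑ p : ι × ι, w p.1 * w p.2 = 1 := by rw [sum_fst_mul_snd, hw, one_mul]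
  have hsq' : ∑ p : κ × κ, w' p.1 * w' p.2 = 1 := by rw [sum_fst_mul_snd, hw', one_mul]
  have hinj : Set.InjOn (fun z : ℤ × ℤ => z.1 + N * z.2)
      (Set.range fun p : (ι × ι) × (κ × κ) => (u p.1, v p.2)) := by
    rintro _ ⟨⟨p, q⟩, rfl⟩ _ ⟨⟨p', q'⟩, rfl⟩ h
    have hp := abs_le.1 (hu p)
    have hp' := abs_le.1 (hu p')
    have hdiff : u p - u p' = 0 := by
      refine Int.eq_zero_of_abs_lt_dvd (m := N) ⟨v q' - v q, ?_⟩ ?_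
      · simp only at h
        linear_combination h
      · rw [abs_lt]
        constructor <;> linarith
    have hNv : N * v q = N * v q' := by
      simp only at h
      linarith
    have hN0 : N ≠ 0 := by
      have := (abs_nonneg _).trans (hu p)
      omega
    exact Prod.ext (sub_eq_zero.1 hdiff) (mul_left_cancel₀ hN0 hNv)
  rw [← finEnt_prod hsq hsq', ← finEnt_comp_of_injOn _ _ hinj,
    ← finEnt_comp_equiv _ _ (Equiv.prodProdProdComm ι κ ι κ)]
  congr 1
  funext q
  simp only [Equiv.prodProdProdComm_apply]
  ring

lemma IsEntropyGap.add {M M' : ℝ} (h : IsEntropyGap M) (h' : IsEntropyGap M') :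
    IsEntropyGap (M + M') := by
  obtain ⟨ι, _, w, f, hw0, hw, rfl⟩ := h
  obtain ⟨κ, _, w', f', hw0', hw', rfl⟩ := h'
  set B : ℤ := ∑ i, |f i|
  have hB (i : ι) : |f i| ≤ B :=
    Finset.single_le_sum (fun j _ => abs_nonneg (f j)) (Finset.mem_univ i)
  refine ⟨ι × κ, inferInstance, fun p => w p.1 * w' p.2,
    fun p => f p.1 + (2 * (2 * B) + 1) * f' p.2,
    fun p => mul_nonneg (hw0 _) (hw0' _), ?_, ?_⟩
  · rw [sum_fst_mul_snd, hw, hw', one_mul]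
  · have hadd := finEnt_add_mul hw hw' (fun p => f p.1 + f p.2) (fun p => f' p.1 + f' p.2)
      (K := 2 * B) (N := 2 * (2 * B) + 1)
      (fun p => by linarith [abs_add_le (f p.1) (f p.2), hB p.1, hB p.2]) (by linarith)
    have hsub := finEnt_add_mul hw hw' (fun p => f p.1 - f p.2) (fun p => f' p.1 - f' p.2)
      (K := 2 * B) (N := 2 * (2 * B) + 1)
      (fun p => by linarith [abs_sub (f p.1) (f p.2), hB p.1, hB p.2]) (by linarith)
    unfold entropyGap
    rw [sub_add_sub_comm, ← hadd, ← hsub]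
    congr 2 <;> funext q <;> ring

lemma IsEntropyGap.succ_mul {M : ℝ} (h : IsEntropyGap M) (n : ℕ) :
    IsEntropyGap ((n + 1) * M) := by
  induction n with
  | zero => simpa using h
  | succ n ih =>
    convert ih.add h using 1
    push_cast
    ring

/-- `∏ c ^ c` over the multiplicities `c` of the values of `g` on pairs weighted by `W`. -/
def fiberPowProd {ι : Type*} [Fintype ι] (W : ι → ℕ) (g : ι × ι → ℤ) : ℕ :=
  ∏ z ∈ Finset.univ.image g,
    (∑ p with g p = z, W p.1 * W p.2) ^ (∑ p with g p = z, W p.1 * W p.2)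

lemma entropyGap_natCast_div {ι : Type*} [Fintype ι] (W : ι → ℕ) (f : ι → ℤ) {n : ℕ}
    (hn : n ≠ 0) (hW : ∑ i, W i = n) :
    entropyGap (fun i => (W i : ℝ) / n) f =
      (Real.log (fiberPowProd W fun p => f p.1 - f p.2) -
        Real.log (fiberPowProd W fun p => f p.1 + f p.2)) / (n * n : ℕ) := by
  have hweights : (fun p : ι × ι => (W p.1 : ℝ) / n * (W p.2 / n)) =
      fun p => ((W p.1 * W p.2 : ℕ) : ℝ) / (n * n : ℕ) := by
    funext p
    push_cast
    ring
  have htotal : ∑ p : ι × ι, W p.1 * W p.2 = n * n := by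
    rw [sum_fst_mul_snd, hW]
  unfold entropyGap fiberPowProd
  rw [hweights, finEnt_natCast_div _ _ (mul_ne_zero hn hn) htotal,
    finEnt_natCast_div _ _ (mul_ne_zero hn hn) htotal]
  ring

/-- The indicator of the Sidon subset `{0, 2, 3}` of Conway's set. -/
def sidonWeight : Fin 8 → ℕ := ![1, 1, 1, 0, 0, 0, 0, 0]

lemma entropyGap_conwaySet_pos :
    0 < entropyGap (fun i => (((fun _ => 1 : Fin 8 → ℕ) i : ℕ) : ℝ) / (8 : ℕ)) conwaySet := by
  rw [entropyGap_natCast_div _ _ (by norm_num) (by simp)]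
  have hpos : 0 < fiberPowProd (fun _ => 1) fun p => conwaySet p.1 + conwaySet p.2 := by
    decide +kernel
  have hlt : fiberPowProd (fun _ => 1) (fun p => conwaySet p.1 + conwaySet p.2) <
      fiberPowProd (fun _ => 1) fun p => conwaySet p.1 - conwaySet p.2 := by
    decide +kernel
  exact div_pos (sub_pos.2 (Real.log_lt_log (by exact_mod_cast hpos) (by exact_mod_cast hlt)))
    (by norm_num)

lemma entropyGap_sidonWeight_neg :
    entropyGap (fun i => (sidonWeight i : ℝ) / (3 : ℕ)) conwaySet < 0 := by
  rw [entropyGap_natCast_div _ _ (by norm_num) (by decide)]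
  have hpos : 0 < fiberPowProd sidonWeight fun p => conwaySet p.1 - conwaySet p.2 := by
    decide +kernel
  have hlt : fiberPowProd sidonWeight (fun p => conwaySet p.1 - conwaySet p.2) <
      fiberPowProd sidonWeight fun p => conwaySet p.1 + conwaySet p.2 := by
    decide +kernel
  exact div_neg_of_neg_of_pos
    (sub_neg.2 (Real.log_lt_log (by exact_mod_cast hpos) (by exact_mod_cast hlt))) (by norm_num)

lemma isEntropyGap_of_mem_Icc {ι : Type} [Fintype ι] {w w' : ι → ℝ} (hw0 : ∀ i, 0 ≤ w i)
    (hw : ∑ i, w i = 1) (hw0' : ∀ i, 0 ≤ w' i) (hw' : ∑ i, w' i = 1) (f : ι → ℤ) {M : ℝ}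
    (hM : M ∈ Set.Icc (entropyGap w f) (entropyGap w' f)) : IsEntropyGap M := by
  have hcont : Continuous fun t : ℝ => entropyGap (fun i => (1 - t) * w i + t * w' i) f :=
    (continuous_finEnt (fun p => by fun_prop) _).sub (continuous_finEnt (fun p => by fun_prop) _)
  obtain ⟨t, ht, rfl⟩ := intermediate_value_Icc zero_le_one hcont.continuousOn
    (show M ∈ Set.Icc _ _ by simpa using hM)
  refine ⟨ι, inferInstance, _, f, fun i => ?_, ?_, rfl⟩
  · exact add_nonneg (mul_nonneg (sub_nonneg.2 ht.2) (hw0 i)) (mul_nonneg ht.1 (hw0' i))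
  · rw [Finset.sum_add_distrib, ← Finset.mul_sum, ← Finset.mul_sum, hw, hw']
    ring

lemma isEntropyGap (M : ℝ) : IsEntropyGap M := by
  have hneg := entropyGap_sidonWeight_neg
  have hpos := entropyGap_conwaySet_pos
  have hlim : Filter.Tendsto (fun n : ℕ => M / ((n : ℝ) + 1)) Filter.atTop (nhds 0) := by
    simpa [div_eq_mul_inv] using tendsto_one_div_add_atTop_nhds_zero_nat.const_mul M
  obtain ⟨n, hn⟩ := (hlim.eventually (Icc_mem_nhds hneg hpos)).exists
  have hgap : IsEntropyGap (M / ((n : ℝ) + 1)) :=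
    isEntropyGap_of_mem_Icc (fun i => by positivity)
      (by rw [← Finset.sum_div, ← Nat.cast_sum, show ∑ i, sidonWeight i = 3 by decide]; norm_num)
      (fun i => by positivity) (by simp) conwaySet hn
  have hmul := hgap.succ_mul n
  rwa [mul_div_cancel₀ _ (by positivity)] at hmul

/-- for every real `M` there exist i.i.d. `ℤ`-valued
random variables `X, Y` with finite entropy (indeed finite support) such that
`H(X+Y) - H(X-Y) = M`. -/
theorem exists_iid_entropy_add_sub_eq (M : ℝ) :
    ∃ (Ω : Type) (_ : MeasurableSpace Ω) (P : Measure Ω) (X Y : Ω → ℤ),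
      IsProbabilityMeasure P ∧ Measurable X ∧ Measurable Y ∧
      IndepFun X Y P ∧ IdentDistrib X Y P P ∧
      (Set.range X).Finite ∧
      Summable (fun z : ℤ => Real.negMulLog (P (X ⁻¹' {z})).toReal) ∧
      shEnt P (fun ω => X ω + Y ω) - shEnt P (fun ω => X ω - Y ω) = M := by
  obtain ⟨ι, _, w, f, hw0, hw, rfl⟩ := isEntropyGap M
  let _ : MeasurableSpace ι := ⊤
  have hsum : ∑ i, ENNReal.ofReal (w i) = 1 := by
    rw [← ENNReal.ofReal_sum_of_nonneg fun i _ => hw0 i, hw, ENNReal.ofReal_one]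
  set μ : Measure ι := (PMF.ofFintype _ hsum).toMeasure with hμ
  have hμw (i : ι) : μ.real {i} = w i := by
    rw [hμ, measureReal_def, PMF.toMeasure_apply_singleton _ _ (measurableSet_singleton i),
      PMF.ofFintype_apply, ENNReal.toReal_ofReal (hw0 i)]
  have hprod : (fun p : ι × ι => (μ.prod μ).real {p}) = fun p => w p.1 * w p.2 := by
    funext p
    rw [← Set.singleton_prod_singleton, measureReal_prod_prod, hμw, hμw]
  have hf : Measurable f := measurable_from_top
  have hrange : (Set.range fun p : ι × ι => f p.1).Finite := Set.finite_range _
  refine ⟨ι × ι, inferInstance, μ.prod μ, fun p => f p.1, fun p => f p.2, inferInstance,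
    hf.comp measurable_fst, hf.comp measurable_snd, indepFun_prod hf hf, ?_, hrange, ?_, ?_⟩
  · refine ⟨(hf.comp measurable_fst).aemeasurable, (hf.comp measurable_snd).aemeasurable, ?_⟩
    have hfst := Measure.map_map (μ := μ.prod μ) hf measurable_fst
    have hsnd := Measure.map_map (μ := μ.prod μ) hf measurable_snd
    rw [Measure.map_fst_prod] at hfst
    rw [Measure.map_snd_prod] at hsnd
    exact hfst.symm.trans hsnd
  · refine summable_of_hasFiniteSupport (hrange.subset fun z hz => ?_)
    by_contra hmem
    refine hz ?_
    simp only [Set.preimage_singleton_eq_empty.2 hmem]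
    simp
  · rw [shEnt_eq_finEnt, shEnt_eq_finEnt, hprod, entropyGap]
end

section
/- Let X', Y' be i.i.d. ℤ-valued random variables with finite Shannon entropy, let U, V be i.i.d. random variables uniformly distributed on the interval (−1/4, 1/4), with X', Y', U, V mutually independent, and set X = X' + U and Y = Y' + V. Then h(X+Y) = H(X'+Y') + h(U+V) and h(X−Y) = H(X'−Y') + h(U−V); since U+V and U−V have the same distribution, consequently h(X+Y) − h(X−Y) = H(X'+Y') − H(X'−Y'). -/
open MeasureTheory ProbabilityTheory

/-- Differential entropy (in nats) of a real-valued random variable `W` with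
density `f` (w.r.t. Lebesgue measure): `h(W) = -∫ f log f`. -/
noncomputable def diffEnt {Ω : Type*} [MeasurableSpace Ω] (P : Measure Ω) (W : Ω → ℝ) : ℝ :=
  ∫ x, Real.negMulLog ((MeasureTheory.pdf W P volume) x).toReal

open scoped ENNReal

section ShannonEntropy

variable {Ω S T : Type*} [MeasurableSpace Ω] {P : Measure Ω}

/-- The point masses of a discrete random variable sum to its probability of lying in a set. -/
lemma hasSum_measureReal_preimage_singleton [IsFiniteMeasure P] [Countable S] [MeasurableSpace S]
    [MeasurableSingletonClass S] {Z : Ω → S} (hZ : Measurable Z) (A : Set S) :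
    HasSum (fun s : A => (P (Z ⁻¹' {(s : S)})).toReal) (P (Z ⁻¹' A)).toReal := by
  have h := tsum_measure_preimage_singleton (μ := P) A.to_countable (f := Z)
    fun y _ => hZ (measurableSet_singleton y)
  have hne : ∑' b : A, P (Z ⁻¹' {(b : S)}) ≠ ∞ := by rw [h]; exact measure_ne_top _ _
  rw [← h, ENNReal.tsum_toReal_eq (ENNReal.ne_top_of_tsum_ne_top hne)]
  exact ENNReal.hasSum_toReal hne

/-- The point masses of a discrete random variable sum to one. -/
lemma hasSum_measureReal_singleton [IsProbabilityMeasure P] [Countable S] [MeasurableSpace S]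
    [MeasurableSingletonClass S] {Z : Ω → S} (hZ : Measurable Z) :
    HasSum (fun s => (P (Z ⁻¹' {s})).toReal) 1 := by
  have h := hasSum_measureReal_preimage_singleton (P := P) hZ Set.univ
  rw [Set.preimage_univ, measure_univ, ENNReal.toReal_one] at h
  exact (Equiv.Set.univ S).hasSum_iff.mp h

lemma negMulLog_measure_toReal_nonneg [IsProbabilityMeasure P] (A : Set Ω) :
    0 ≤ Real.negMulLog (P A).toReal :=
  Real.negMulLog_nonneg ENNReal.toReal_nonneg measureReal_le_one

/-- A function of a discrete random variable with finite entropy has finite entropy. -/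
lemma summable_negMulLog_comp [IsProbabilityMeasure P] [Countable S] [MeasurableSpace S]
    [MeasurableSingletonClass S] {Z : Ω → S} (hZ : Measurable Z) (f : S → T)
    (h : Summable fun s => Real.negMulLog (P (Z ⁻¹' {s})).toReal) :
    Summable fun t => Real.negMulLog (P ((fun ω => f (Z ω)) ⁻¹' {t})).toReal := by
  have hσ : Summable fun x : (Σ t, {s // f s = t}) =>
      Real.negMulLog (P (Z ⁻¹' {(x.2 : S)})).toReal :=
    (Equiv.sigmaFiberEquiv f).summable_iff.mpr h
  refine hσ.sigma.of_nonneg_of_le (fun t => negMulLog_measure_toReal_nonneg _) fun t => ?_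
  have hq := hasSum_measureReal_preimage_singleton (P := P) hZ (f ⁻¹' {t})
  have hset : (fun ω => f (Z ω)) ⁻¹' {t} = Z ⁻¹' (f ⁻¹' {t}) := rfl
  rw [hset]
  set q := (P (Z ⁻¹' (f ⁻¹' {t}))).toReal
  have hq' := hq.mul_right (-Real.log q)
  have heq : q * -Real.log q = Real.negMulLog q := by rw [Real.negMulLog]; ring
  rw [heq] at hq'
  refine hasSum_le (fun s => ?_) hq' (hσ.sigma_factor t).hasSum
  have hle : (P (Z ⁻¹' {(s : S)})).toReal ≤ q :=
    ENNReal.toReal_mono (measure_ne_top _ _)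
      (measure_mono (Set.preimage_mono (Set.singleton_subset_iff.mpr s.2)))
  rcases ENNReal.toReal_nonneg.eq_or_lt' with h0 | h0
  · exact le_of_eq (by rw [h0]; simp)
  · have := mul_le_mul_of_nonneg_left (Real.log_le_log h0 hle) h0.le
    simp only [Real.negMulLog]
    linarith

/-- A pair of independent discrete random variables with finite entropies has finite entropy. -/
lemma summable_negMulLog_prodMk [IsProbabilityMeasure P] [Countable S] [MeasurableSpace S]
    [MeasurableSingletonClass S] [Countable T] [MeasurableSpace T] [MeasurableSingletonClass T]
    {Y : Ω → S} {Z : Ω → T} (hY : Measurable Y) (hZ : Measurable Z) (hind : IndepFun Y Z P)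
    (hYs : Summable fun s => Real.negMulLog (P (Y ⁻¹' {s})).toReal)
    (hZs : Summable fun t => Real.negMulLog (P (Z ⁻¹' {t})).toReal) :
    Summable fun x : S × T => Real.negMulLog (P ((fun ω => (Y ω, Z ω)) ⁻¹' {x})).toReal := by
  have hsum := (hYs.mul_of_nonneg (hasSum_measureReal_singleton (P := P) hZ).summable
    (fun _ => negMulLog_measure_toReal_nonneg _) fun _ => ENNReal.toReal_nonneg).add
      ((hasSum_measureReal_singleton (P := P) hY).summable.mul_of_nonneg hZs
      (fun _ => ENNReal.toReal_nonneg) fun _ => negMulLog_measure_toReal_nonneg _)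
  refine hsum.congr fun x => ?_
  have hset : (fun ω => (Y ω, Z ω)) ⁻¹' {x} = Y ⁻¹' {x.1} ∩ Z ⁻¹' {x.2} := by
    ext ω; simp [Prod.ext_iff]
  rw [hset, hind.measure_inter_preimage_eq_mul _ _ (measurableSet_singleton _)
    (measurableSet_singleton _), ENNReal.toReal_mul, Real.negMulLog_mul]
  ring

end ShannonEntropy

section DifferentialEntropy

variable {Ω : Type*} [MeasurableSpace Ω] {P : Measure Ω}

/-- The law of a sum of independent variables, by conditioning on the first one. -/
lemma map_add_apply_of_indepFun [IsProbabilityMeasure P] {A B : Ω → ℝ}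
    (hA : Measurable A) (hB : Measurable B)
    (hind : IndepFun A B P) {s : Set ℝ} (hs : MeasurableSet s) :
    P.map (fun ω => A ω + B ω) s = ∫⁻ a, P.map B ((fun b => a + b) ⁻¹' s) ∂(P.map A) := by
  have h : (fun ω => A ω + B ω) = (fun x : ℝ × ℝ => x.1 + x.2) ∘ fun ω => (A ω, B ω) := rfl
  rw [h, ← Measure.map_map (by fun_prop) (by fun_prop),
    hind.map_prod_eq_prod_map_map hA.aemeasurable hB.aemeasurable,
    Measure.map_apply (by fun_prop) hs, Measure.prod_apply (hs.preimage (by fun_prop))]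
  rfl

/-- Adding an independent variable preserves an upper bound on the density. -/
lemma map_add_le_smul_volume [IsProbabilityMeasure P] {A B : Ω → ℝ}
    (hA : Measurable A) (hB : Measurable B)
    (hind : IndepFun A B P) {c : ℝ≥0∞} (hc : P.map B ≤ c • volume) :
    P.map (fun ω => A ω + B ω) ≤ c • volume := by
  have := Measure.isProbabilityMeasure_map (μ := P) hA.aemeasurable
  refine Measure.le_iff.mpr fun s hs => ?_
  rw [map_add_apply_of_indepFun hA hB hind hs]
  calc ∫⁻ a, P.map B ((fun b => a + b) ⁻¹' s) ∂(P.map A)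
      ≤ ∫⁻ _, c * volume s ∂(P.map A) := by
        refine lintegral_mono fun a => (hc _).trans_eq ?_
        rw [Measure.smul_apply, smul_eq_mul, measure_preimage_add]
    _ = (c • volume) s := by simp

lemma hasPDF_of_map_le_smul_volume [IsProbabilityMeasure P] {W : Ω → ℝ}
    (hW : Measurable W) {c : ℝ≥0∞} (hc : P.map W ≤ c • volume) : HasPDF W P volume :=
  hasPDF_iff.mpr ⟨hW.aemeasurable, inferInstance,
    (Measure.absolutelyContinuous_of_le hc).trans Measure.smul_absolutelyContinuous⟩

/-- The density of a variable lying almost surely in `s` can be taken to vanish off `s`. -/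
lemma pdf_ae_eq_indicator {W : Ω → ℝ} [HasPDF W P volume] (hW : Measurable W) {s : Set ℝ}
    (hs : MeasurableSet s) (hWs : ∀ᵐ ω ∂P, W ω ∈ s) :
    pdf W P volume =ᵐ[volume] s.indicator (pdf W P volume) := by
  have hz : ∫⁻ x in sᶜ, pdf W P volume x = 0 := by
    rw [← map_eq_setLIntegral_pdf W P volume hs.compl, Measure.map_apply hW hs.compl]
    exact hWs
  rw [lintegral_eq_zero_iff (measurable_pdf W P volume), Filter.EventuallyEq,
    ae_restrict_iff' hs.compl] at hz
  filter_upwards [hz] with x hx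
  by_cases hxs : x ∈ s
  · simp [hxs]
  · simpa [hxs] using hx hxs

/-- A bounded density with bounded support has an integrable entropy integrand. -/
lemma integrable_negMulLog_pdf [IsProbabilityMeasure P] {W : Ω → ℝ}
    (hW : Measurable W) {c : ℝ≥0∞} (hctop : c ≠ ∞)
    (hc : P.map W ≤ c • volume) {s : Set ℝ} (hs : MeasurableSet s) (hsfin : volume s ≠ ∞)
    (hWs : ∀ᵐ ω ∂P, W ω ∈ s) :
    Integrable fun x => Real.negMulLog (pdf W P volume x).toReal := by
  have := hasPDF_of_map_le_smul_volume hW hc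
  have hle : pdf W P volume ≤ᵐ[volume] fun _ => c := by
    refine ae_le_of_forall_setLIntegral_le_of_sigmaFinite (measurable_pdf W P volume)
      fun t ht _ => ?_
    rw [← map_eq_setLIntegral_pdf W P volume ht]
    simpa using hc t
  obtain ⟨C, hC⟩ := (isCompact_Icc (a := 0) (b := c.toReal)).exists_bound_of_continuousOn
    Real.continuous_negMulLog.continuousOn
  have hmeas : Measurable fun x => Real.negMulLog (pdf W P volume x).toReal :=
    Real.continuous_negMulLog.measurable.comp (measurable_pdf W P volume).ennreal_toReal
  have hint : Integrable (s.indicator fun _ => C) :=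
    (integrable_indicator_iff hs).mpr (integrableOn_const hsfin)
  refine hint.mono' hmeas.aestronglyMeasurable ?_
  filter_upwards [hle, pdf_ae_eq_indicator hW hs hWs] with x hx hxs
  by_cases hmem : x ∈ s
  · rw [Set.indicator_of_mem hmem]
    exact hC _ ⟨ENNReal.toReal_nonneg, ENNReal.toReal_mono hctop hx⟩
  · rw [Set.indicator_of_notMem hmem] at hxs ⊢
    simp [hxs]

/-- The density of the sum of an integer-valued variable and an independent variable with
density `g` is the mixture of the translates of `g`. -/
lemma map_intCast_add_eq_withDensity [IsProbabilityMeasure P] {N : Ω → ℤ} {W : Ω → ℝ}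
    (hN : Measurable N) (hW : Measurable W) (hind : IndepFun N W P) {g : ℝ → ℝ≥0∞}
    (hg : Measurable g) (hWg : P.map W = volume.withDensity g) :
    P.map (fun ω => (N ω : ℝ) + W ω)
      = volume.withDensity fun x => ∑' n : ℤ, P (N ⁻¹' {n}) * g (x - n) := by
  have hcast : Measurable fun n : ℤ => (n : ℝ) := by fun_prop
  ext s hs
  rw [map_add_apply_of_indepFun (A := fun ω => (N ω : ℝ)) (hcast.comp hN) hW
      (hind.comp hcast measurable_id) hs, ← Function.comp_def (fun n : ℤ => (n : ℝ)) N,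
    ← Measure.map_map hcast hN, lintegral_map' _ hcast.aemeasurable, lintegral_countable',
    withDensity_apply _ hs, lintegral_tsum (fun n => by fun_prop)]
  · refine tsum_congr fun n => ?_
    have hpre : MeasurableSet ((fun b : ℝ => (n : ℝ) + b) ⁻¹' s) := hs.preimage (by fun_prop)
    rw [lintegral_const_mul _ (by fun_prop), mul_comm, Measure.map_apply hN (by simp), hWg,
      withDensity_apply _ hpre, ← lintegral_indicator hpre, ← lintegral_indicator hs,
      ← lintegral_sub_right_eq_self (μ := volume) _ (n : ℝ)]
    congr 1
    refine lintegral_congr fun x => ?_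
    have hmem : x - n ∈ (fun b : ℝ => (n : ℝ) + b) ⁻¹' s ↔ x ∈ s := by
      rw [Set.mem_preimage, add_sub_cancel]
    by_cases hx : x ∈ s
    · rw [Set.indicator_of_mem hx, Set.indicator_of_mem (hmem.mpr hx)]
    · rw [Set.indicator_of_notMem hx, Set.indicator_of_notMem (mt hmem.mp hx)]
  · have := measurable_measure_prodMk_left (ν := P.map W)
      (hs.preimage (measurable_fst.add measurable_snd : Measurable fun x : ℝ × ℝ => x.1 + x.2))
    exact this.aemeasurable

/-- At most one integer translate of a function supported in `(-1/2, 1/2)` is nonzero at a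
given point. -/
lemma sub_intCast_notMem_Ioo {x : ℝ} {n : ℤ} (hn : n ≠ round x) :
    x - n ∉ Set.Ioo (-(1 / 2) : ℝ) (1 / 2) := by
  rintro ⟨h1, h2⟩
  exact hn (round_eq_iff.mpr ⟨by linarith, by linarith⟩).symm

/-- The entropy of an integer-valued variable plus an independent variable with values in
`(-1/2, 1/2)` splits as the sum of the entropies. -/
lemma diffEnt_intCast_add [IsProbabilityMeasure P] {N : Ω → ℤ} {W : Ω → ℝ}
    (hN : Measurable N) (hW : Measurable W)
    (hind : IndepFun N W P) (hNs : Summable fun n => Real.negMulLog (P (N ⁻¹' {n})).toReal)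
    [HasPDF W P volume] (hWs : ∀ᵐ ω ∂P, W ω ∈ Set.Ioo (-(1 / 2) : ℝ) (1 / 2))
    (hint : Integrable fun x => Real.negMulLog (pdf W P volume x).toReal) :
    diffEnt P (fun ω => (N ω : ℝ) + W ω) = shEnt P N + diffEnt P W := by
  set g : ℝ → ℝ≥0∞ := (Set.Ioo (-(1 / 2) : ℝ) (1 / 2)).indicator (pdf W P volume)
  have hg : Measurable g := (measurable_pdf W P volume).indicator measurableSet_Ioo
  have hpdfW : pdf W P volume =ᵐ[volume] g := pdf_ae_eq_indicator hW measurableSet_Ioo hWs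
  have hWg : P.map W = volume.withDensity g := by
    rw [map_eq_withDensity_pdf W P volume, withDensity_congr_ae hpdfW]
  have hmap := map_intCast_add_eq_withDensity hN hW hind hg hWg
  have hfmeas : Measurable fun x : ℝ => ∑' n : ℤ, P (N ⁻¹' {n}) * g (x - n) :=
    Measurable.tsum fun n => by fun_prop
  have hmeasAdd : Measurable fun ω => (N ω : ℝ) + W ω := by fun_prop
  have : HasPDF (fun ω => (N ω : ℝ) + W ω) P volume :=
    hasPDF_of_map_eq_withDensity hmeasAdd.aemeasurable _ hfmeas.aemeasurable hmap
  have hpdf := (pdf.eq_of_map_eq_withDensity' _ hfmeas.aemeasurable).mp hmap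
  let p : ℤ → ℝ := fun n => (P (N ⁻¹' {n})).toReal
  let φ : ℝ → ℝ := fun x => (g x).toReal
  have hgint : ∫⁻ x, g x = 1 := by
    rw [← lintegral_congr_ae hpdfW, pdf.lintegral_eq_measure_univ, measure_univ]
  have hφint : Integrable φ :=
    integrable_toReal_of_lintegral_ne_top hg.aemeasurable (by simp [hgint])
  have hφone : ∫ x, φ x = 1 := by
    rw [integral_toReal hg.aemeasurable (ae_lt_top hg (by simp [hgint])), hgint,
      ENNReal.toReal_one]
  have hae : (fun x => Real.negMulLog (pdf W P volume x).toReal)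
      =ᵐ[volume] fun x => Real.negMulLog (φ x) := hpdfW.fun_comp fun y => Real.negMulLog y.toReal
  have hψint : Integrable fun x => Real.negMulLog (φ x) := hint.congr hae
  have hψ : diffEnt P W = ∫ x, Real.negMulLog (φ x) := integral_congr_ae hae
  have hp : HasSum p 1 := hasSum_measureReal_singleton hN
  let F : ℤ → ℝ → ℝ := fun n x => φ (x - n) * Real.negMulLog (p n)
    + p n * Real.negMulLog (φ (x - n))
  have hFint (n : ℤ) : Integrable (F n) :=
    ((hφint.comp_sub_right (n : ℝ)).mul_const _).add ((hψint.comp_sub_right (n : ℝ)).const_mul _)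
  have hFval (n : ℤ) : ∫ x, F n x
      = Real.negMulLog (p n) + p n * ∫ x, Real.negMulLog (φ x) := by
    rw [integral_add ((hφint.comp_sub_right (n : ℝ)).mul_const _)
      ((hψint.comp_sub_right (n : ℝ)).const_mul _), integral_mul_const, integral_const_mul,
      integral_sub_right_eq_self φ (n : ℝ),
      integral_sub_right_eq_self (fun x => Real.negMulLog (φ x)) (n : ℝ), hφone, one_mul]
  have hFnorm : Summable fun n => ∫ x, ‖F n x‖ := by
    refine (hNs.add (hp.summable.mul_right (∫ x, ‖Real.negMulLog (φ x)‖))).of_nonneg_of_le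
      (fun n => integral_nonneg fun x => norm_nonneg _) fun n => ?_
    calc ∫ x, ‖F n x‖
        ≤ ∫ x, (φ (x - n) * Real.negMulLog (p n) + p n * ‖Real.negMulLog (φ (x - n))‖) := by
          refine integral_mono (hFint n).norm
            (((hφint.comp_sub_right (n : ℝ)).mul_const _).add
              ((hψint.norm.comp_sub_right (n : ℝ)).const_mul _)) fun x => ?_
          refine (norm_add_le _ _).trans_eq ?_
          rw [norm_mul (p n), Real.norm_of_nonneg (mul_nonneg ENNReal.toReal_nonneg
            (negMulLog_measure_toReal_nonneg _)), Real.norm_of_nonneg (r := p n)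
            ENNReal.toReal_nonneg]
      _ = Real.negMulLog (p n) + p n * ∫ x, ‖Real.negMulLog (φ x)‖ := by
          rw [integral_add ((hφint.comp_sub_right (n : ℝ)).mul_const _)
            ((hψint.norm.comp_sub_right (n : ℝ)).const_mul _), integral_mul_const,
            integral_const_mul, integral_sub_right_eq_self φ (n : ℝ),
            integral_sub_right_eq_self (fun x => ‖Real.negMulLog (φ x)‖) (n : ℝ), hφone, one_mul]
  have hpoint (x : ℝ) : Real.negMulLog (∑' n : ℤ, P (N ⁻¹' {n}) * g (x - n)).toReal
      = ∑' n, F n x := by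
    have hzero (n : ℤ) (hn : n ≠ round x) : g (x - n) = 0 :=
      Set.indicator_of_notMem (sub_intCast_notMem_Ioo hn) _
    rw [tsum_eq_single (round x) fun n hn => by rw [hzero n hn, mul_zero],
      tsum_eq_single (round x) fun n hn => by simp [F, φ, hzero n hn],
      ENNReal.toReal_mul, Real.negMulLog_mul]
  calc diffEnt P (fun ω => (N ω : ℝ) + W ω)
      = ∫ x, ∑' n, F n x := by
        refine integral_congr_ae ?_
        filter_upwards [hpdf] with x hx
        rw [hx, hpoint]
    _ = ∑' n, ∫ x, F n x := (integral_tsum_of_summable_integral_norm hFint hFnorm).symm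
    _ = shEnt P N + diffEnt P W := by
        simp_rw [hFval]
        rw [Summable.tsum_add hNs (hp.summable.mul_right _), tsum_mul_right, hp.tsum_eq, one_mul,
          hψ]
        rfl

lemma isUniform_neg {V : Ω → ℝ} (hV : Measurable V) {s : Set ℝ} (hs : MeasurableSet s)
    (hsymm : -s = s) (h : pdf.IsUniform V s P volume) :
    pdf.IsUniform (fun ω => -V ω) s P volume := by
  have hcomp : (fun ω => -V ω) = Neg.neg ∘ V := rfl
  rw [pdf.IsUniform, hcomp, ← Measure.map_map measurable_neg hV, h]
  ext t ht
  rw [Measure.map_apply measurable_neg ht, cond_apply hs, cond_apply hs]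
  congr 1
  rw [← Measure.measure_neg volume (s ∩ t), Set.inter_neg, hsymm]
  rfl

lemma isUniform_map_le {V : Ω → ℝ} {s : Set ℝ} (h : pdf.IsUniform V s P volume) :
    P.map V ≤ (volume s)⁻¹ • volume := by
  rw [h, ProbabilityTheory.cond]
  gcongr
  exact Measure.restrict_le_self

lemma isUniform_ae_mem {V : Ω → ℝ} (hV : Measurable V) {s : Set ℝ} (hs : MeasurableSet s)
    (h : pdf.IsUniform V s P volume) : ∀ᵐ ω ∂P, V ω ∈ s := by
  refine ae_of_ae_map hV.aemeasurable ?_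
  rw [h]
  exact ae_cond_mem hs

/-- Entropy splits for an integer-valued variable plus a sum of two independent variables
uniform on `(-1/4, 1/4)`. -/
lemma diffEnt_intCast_add_uniform_add [IsProbabilityMeasure P] {N : Ω → ℤ} {U V : Ω → ℝ}
    (hN : Measurable N) (hU : Measurable U) (hV : Measurable V) (hindUV : IndepFun U V P)
    (hind : IndepFun N (fun ω => U ω + V ω) P)
    (hNs : Summable fun n => Real.negMulLog (P (N ⁻¹' {n})).toReal)
    (hUunif : pdf.IsUniform U (Set.Ioo (-(1/4) : ℝ) (1/4)) P volume)
    (hVunif : pdf.IsUniform V (Set.Ioo (-(1/4) : ℝ) (1/4)) P volume) :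
    diffEnt P (fun ω => (N ω : ℝ) + (U ω + V ω))
      = shEnt P N + diffEnt P (fun ω => U ω + V ω) := by
  have hle := map_add_le_smul_volume hU hV hindUV (isUniform_map_le hVunif)
  have hW : Measurable fun ω => U ω + V ω := hU.add hV
  have := hasPDF_of_map_le_smul_volume hW hle
  have hWs : ∀ᵐ ω ∂P, U ω + V ω ∈ Set.Ioo (-(1 / 2) : ℝ) (1 / 2) := by
    filter_upwards [isUniform_ae_mem hU measurableSet_Ioo hUunif,
      isUniform_ae_mem hV measurableSet_Ioo hVunif] with ω hu hv
    exact ⟨by linarith [hu.1, hv.1], by linarith [hu.2, hv.2]⟩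
  refine diffEnt_intCast_add hN hW hind hNs hWs
    (integrable_negMulLog_pdf hW ?_ hle measurableSet_Ioo (by simp) hWs)
  rw [Real.volume_Ioo]
  norm_num

/-- Differential entropy depends only on the law. -/
lemma diffEnt_congr_map {W Z : Ω → ℝ} (h : P.map W = P.map Z) : diffEnt P W = diffEnt P Z := by
  simp only [diffEnt, pdf_def, h]

end DifferentialEntropy

/-- If `X', Y'` are i.i.d. `ℤ`-valued with finite entropy, `U, V`
are i.i.d. uniform on `(-1/4, 1/4)`, the four variables are mutually
independent, and `X = X' + U`, `Y = Y' + V`, then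
`h(X+Y) = H(X'+Y') + h(U+V)`, `h(X-Y) = H(X'-Y') + h(U-V)`, and consequently
`h(X+Y) - h(X-Y) = H(X'+Y') - H(X'-Y')`. -/
theorem diffEnt_add_sub_of_discrete_plus_uniform
    {Ω : Type*} [MeasurableSpace Ω] (P : Measure Ω) [IsProbabilityMeasure P]
    (X' Y' : Ω → ℤ) (U V : Ω → ℝ)
    (hX' : Measurable X') (hY' : Measurable Y') (hU : Measurable U) (hV : Measurable V)
    (hidXY : IdentDistrib X' Y' P P) (hidUV : IdentDistrib U V P P)
    (hindXY : IndepFun X' Y' P) (hindUV : IndepFun U V P)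
    (hindPairs : IndepFun (fun ω => (X' ω, Y' ω)) (fun ω => (U ω, V ω)) P)
    (hfinEnt : Summable fun z : ℤ => Real.negMulLog (P (X' ⁻¹' {z})).toReal)
    (hUunif : pdf.IsUniform U (Set.Ioo (-(1/4) : ℝ) (1/4)) P volume)
    (hVunif : pdf.IsUniform V (Set.Ioo (-(1/4) : ℝ) (1/4)) P volume)
    (X Y : Ω → ℝ)
    (hX : X = fun ω => (X' ω : ℝ) + U ω) (hY : Y = fun ω => (Y' ω : ℝ) + V ω) :
    diffEnt P (fun ω => X ω + Y ω)
      = shEnt P (fun ω => X' ω + Y' ω) + diffEnt P (fun ω => U ω + V ω) ∧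
    diffEnt P (fun ω => X ω - Y ω)
      = shEnt P (fun ω => X' ω - Y' ω) + diffEnt P (fun ω => U ω - V ω) ∧
    diffEnt P (fun ω => X ω + Y ω) - diffEnt P (fun ω => X ω - Y ω)
      = shEnt P (fun ω => X' ω + Y' ω) - shEnt P (fun ω => X' ω - Y' ω) := by
  have hYs : Summable fun z : ℤ => Real.negMulLog (P (Y' ⁻¹' {z})).toReal :=
    hfinEnt.congr fun z => by rw [hidXY.measure_mem_eq (measurableSet_singleton z)]
  have hpair := summable_negMulLog_prodMk hX' hY' hindXY hfinEnt hYs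
  have hXY' : Measurable fun ω => (X' ω, Y' ω) := hX'.prodMk hY'
  have hneg := isUniform_neg hV measurableSet_Ioo (by simp) hVunif
  have hVneg : Measurable fun ω => -V ω := hV.neg
  have hindneg : IndepFun U (fun ω => -V ω) P := hindUV.comp measurable_id measurable_neg
  have hadd : diffEnt P (fun ω => X ω + Y ω)
      = shEnt P (fun ω => X' ω + Y' ω) + diffEnt P (fun ω => U ω + V ω) := by
    rw [← diffEnt_intCast_add_uniform_add (N := fun ω => X' ω + Y' ω) (hX'.add hY') hU hV hindUV
      (hindPairs.comp (φ := fun x : ℤ × ℤ => x.1 + x.2)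
        (ψ := fun x : ℝ × ℝ => x.1 + x.2) (by fun_prop) (by fun_prop))
      (summable_negMulLog_comp hXY' (fun x => x.1 + x.2) hpair) hUunif hVunif]
    congr 1
    ext ω
    simp only [hX, hY]
    push_cast
    ring
  have hsub : diffEnt P (fun ω => X ω - Y ω)
      = shEnt P (fun ω => X' ω - Y' ω) + diffEnt P (fun ω => U ω - V ω) := by
    have h := diffEnt_intCast_add_uniform_add (N := fun ω => X' ω - Y' ω) (hX'.sub hY') hU hVneg
      hindneg
      (hindPairs.comp (φ := fun x : ℤ × ℤ => x.1 - x.2)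
        (ψ := fun x : ℝ × ℝ => x.1 + -x.2) (by fun_prop) (by fun_prop))
      (summable_negMulLog_comp hXY' (fun x => x.1 - x.2) hpair) hUunif hneg
    simp only [sub_eq_add_neg (U _)]
    rw [← h]
    congr 1
    ext ω
    simp only [hX, hY]
    push_cast
    ring
  have hlaw : diffEnt P (fun ω => U ω + V ω) = diffEnt P (fun ω => U ω - V ω) := by
    refine diffEnt_congr_map (Measure.ext fun s hs => ?_)
    simp only [sub_eq_add_neg (U _)]
    rw [map_add_apply_of_indepFun hU hV hindUV hs, map_add_apply_of_indepFun hU hVneg hindneg hs,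
      hVunif, hneg]
  exact ⟨hadd, hsub, by rw [hadd, hsub, hlaw]; ring⟩
end

section
/- For every real number M, there exist independent, identically distributed real-valued random variables X and Y, each having a density and finite differential entropy, such that h(X+Y) − h(X−Y) = M. -/
open MeasureTheory ProbabilityTheory

/-- The weight that the image under `f` of the weight `w` gives to the point `k`. -/
def pushWeight {ι κ R : Type*} [Fintype ι] [DecidableEq κ] [AddCommMonoid R]
    (f : ι → κ) (w : ι → R) (k : κ) : R :=
  ∑ i with f i = k, w i

/-- Shannon entropy (in nats) of the image under `f` of the weight `w`. -/
noncomputable def discEnt {ι κ : Type*} [Fintype ι] [DecidableEq κ] (f : ι → κ) (w : ι → ℝ) : ℝ :=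
  ∑ k ∈ Finset.univ.image f, Real.negMulLog (pushWeight f w k)

section Discrete

variable {ι κ α β : Type*} [Fintype ι] [Fintype κ] [DecidableEq α] [DecidableEq β]

lemma sum_pushWeight (f : ι → α) (w : ι → ℝ) :
    ∑ k ∈ Finset.univ.image f, pushWeight f w k = ∑ i, w i :=
  Finset.sum_fiberwise_of_maps_to (fun i _ => Finset.mem_image_of_mem f (Finset.mem_univ i)) w

lemma sum_pushWeight_mul (f : ι → α) (w : ι → ℝ) (G : α → ℝ) :
    ∑ k ∈ Finset.univ.image f, pushWeight f w k * G k = ∑ i, w i * G (f i) := by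
  rw [← Finset.sum_fiberwise_of_maps_to
    (fun i _ => Finset.mem_image_of_mem f (Finset.mem_univ i)) (fun i => w i * G (f i))]
  refine Finset.sum_congr rfl fun k _ => ?_
  rw [pushWeight, Finset.sum_mul]
  refine Finset.sum_congr rfl fun i hi => ?_
  rw [(Finset.mem_filter.1 hi).2]

lemma discEnt_comp_of_injOn (φ : α → β) (f : ι → α) (w : ι → ℝ)
    (hφ : Set.InjOn φ (Set.range f)) : discEnt (φ ∘ f) w = discEnt f w := by
  unfold discEnt
  rw [← Finset.image_image, Finset.sum_image]
  · refine Finset.sum_congr rfl fun k hk => ?_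
    obtain ⟨j, -, rfl⟩ := Finset.mem_image.1 hk
    congr 1
    unfold pushWeight
    congr 1
    ext i
    simp only [Finset.mem_filter, Finset.mem_univ, true_and, Function.comp_apply]
    exact ⟨fun h => hφ ⟨i, rfl⟩ ⟨j, rfl⟩ h, fun h => by rw [h]⟩
  · simpa using hφ

lemma discEnt_comp_equiv (e : κ ≃ ι) (f : ι → α) (w : ι → ℝ) :
    discEnt (f ∘ e) (w ∘ e) = discEnt f w := by
  have himage : Finset.univ.image (f ∘ e) = Finset.univ.image f := by
    ext k
    simp [e.exists_congr_left]
  unfold discEnt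
  rw [himage]
  refine Finset.sum_congr rfl fun k _ => ?_
  congr 1
  unfold pushWeight
  rw [Finset.sum_filter, Finset.sum_filter]
  exact e.sum_comp fun i => if f i = k then w i else 0

lemma discEnt_prodMap (f : ι → α) (g : κ → β) (w : ι → ℝ) (v : κ → ℝ) (hw : ∑ i, w i = 1)
    (hv : ∑ j, v j = 1) :
    discEnt (Prod.map f g) (fun p => w p.1 * v p.2) = discEnt f w + discEnt g v := by
  have hpush (k : α) (l : β) : pushWeight (Prod.map f g) (fun p => w p.1 * v p.2) (k, l)
      = pushWeight f w k * pushWeight g v l := by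
    unfold pushWeight
    rw [Finset.sum_mul_sum, ← Finset.sum_product']
    refine Finset.sum_congr ?_ fun _ _ => rfl
    ext p
    simp [Prod.ext_iff]
  have himage : Finset.univ.image (Prod.map f g)
      = Finset.univ.image f ×ˢ Finset.univ.image g := by
    ext p
    simp [Prod.ext_iff]
  unfold discEnt
  rw [himage, Finset.sum_product]
  simp_rw [hpush, Real.negMulLog_mul, Finset.sum_add_distrib, ← Finset.sum_mul, ← Finset.mul_sum]
  rw [← Finset.sum_mul, sum_pushWeight, sum_pushWeight, hw, hv, one_mul, one_mul]

lemma continuous_discEnt {T : Type*} [TopologicalSpace T] (f : ι → α) {w : T → ι → ℝ}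
    (hw : ∀ i, Continuous fun t => w t i) : Continuous fun t => discEnt f (w t) := by
  unfold discEnt pushWeight
  fun_prop

lemma discEnt_natCast_div (f : ι → α) (n : ι → ℕ) (N : ℕ) (hN : N ≠ 0) (hn : ∑ i, n i = N) :
    discEnt f (fun i => (n i : ℝ) / N) = Real.log N
      - Real.log (∏ k ∈ Finset.univ.image f, pushWeight f n k ^ pushWeight f n k : ℕ) / N := by
  have hN' : (N : ℝ) ≠ 0 := Nat.cast_ne_zero.2 hN
  have hpush (k : α) : pushWeight f (fun i => (n i : ℝ) / N) k
      = ((pushWeight f n k : ℕ) : ℝ) / N := by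
    unfold pushWeight
    rw [← Finset.sum_div, Nat.cast_sum]
  have hterm (k : α) : Real.negMulLog (pushWeight f (fun i => (n i : ℝ) / N) k)
      = pushWeight f (fun i => (n i : ℝ) / N) k * Real.log N
        - Real.log (((pushWeight f n k : ℕ) : ℝ) ^ pushWeight f n k) / N := by
    rw [hpush, Real.negMulLog, Real.log_pow]
    rcases eq_or_ne ((pushWeight f n k : ℕ) : ℝ) 0 with h | h
    · simp [h]
    · rw [Real.log_div h hN']
      ring
  unfold discEnt
  simp_rw [hterm]
  rw [Finset.sum_sub_distrib, ← Finset.sum_mul, sum_pushWeight, ← Finset.sum_div, ← Finset.sum_div,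
    ← Nat.cast_sum, hn, div_self hN', one_mul, Nat.cast_prod, Real.log_prod]
  · simp
  · intro k _
    rw [Nat.cast_ne_zero]
    exact (Nat.pow_self_pos).ne'

end Discrete

/-- The entropy of the sum minus the entropy of the difference of two independent integer-valued
variables, both distributed as the image under `a` of the weight `w`. -/
noncomputable def discEntGap {ι : Type*} [Fintype ι] (a : ι → ℤ) (w : ι → ℝ) : ℝ :=
  discEnt (fun p : ι × ι => a p.1 + a p.2) (fun p => w p.1 * w p.2)
    - discEnt (fun p : ι × ι => a p.1 - a p.2) (fun p => w p.1 * w p.2)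

/-- The numbers `discEntGap a w`, for finitely supported probability weights `w`. -/
def discEntGaps : Set ℝ :=
  {d | ∃ (ι : Type) (_ : Fintype ι) (a : ι → ℤ) (w : ι → ℝ),
    (∀ i, 0 ≤ w i) ∧ ∑ i, w i = 1 ∧ discEntGap a w = d}

lemma injOn_add_mul {K N : ℤ} (hN : 2 * K < N) :
    Set.InjOn (fun q : ℤ × ℤ => q.1 + N * q.2) {q | |q.1| ≤ K} := by
  rintro ⟨u, v⟩ hu ⟨u', v'⟩ hu' h
  simp only [Set.mem_ofPred_eq, abs_le] at hu hu' h
  have hv : v = v' := by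
    rcases lt_trichotomy v v' with hlt | heq | hlt
    · nlinarith
    · exact heq
    · nlinarith
  subst hv
  simpa using h

lemma add_mem_discEntGaps {c d : ℝ} (hc : c ∈ discEntGaps) (hd : d ∈ discEntGaps) :
    c + d ∈ discEntGaps := by
  obtain ⟨ι, _, a, w, hw0, hw1, rfl⟩ := hc
  obtain ⟨κ, _, b, v, hv0, hv1, rfl⟩ := hd
  obtain ⟨K, hK⟩ : ∃ K : ℤ, ∀ i, |a i| ≤ K :=
    ⟨∑ i, |a i|, fun i => Finset.single_le_sum (f := fun i => |a i|)
      (fun _ _ => abs_nonneg _) (Finset.mem_univ i)⟩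
  have hw2 : ∑ p : ι × ι, w p.1 * w p.2 = 1 := by
    rw [Fintype.sum_prod_type, ← Finset.sum_mul_sum, hw1, one_mul]
  have hv2 : ∑ p : κ × κ, v p.1 * v p.2 = 1 := by
    rw [Fintype.sum_prod_type, ← Finset.sum_mul_sum, hv1, one_mul]
  have key (s : ℤ) (hs : |s| = 1) :
      discEnt (fun p : (ι × κ) × (ι × κ) => (a p.1.1 + (4 * K + 1) * b p.1.2)
          + s * (a p.2.1 + (4 * K + 1) * b p.2.2))
        (fun p => (w p.1.1 * v p.1.2) * (w p.2.1 * v p.2.2))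
      = discEnt (fun p : ι × ι => a p.1 + s * a p.2) (fun p => w p.1 * w p.2)
        + discEnt (fun p : κ × κ => b p.1 + s * b p.2) (fun p => v p.1 * v p.2) := by
    rw [← discEnt_prodMap _ _ _ _ hw2 hv2,
      ← discEnt_comp_of_injOn (fun q : ℤ × ℤ => q.1 + (4 * K + 1) * q.2),
      ← discEnt_comp_equiv (Equiv.prodProdProdComm ι κ ι κ)]
    · congr 1
      · ext p
        simp only [Function.comp_apply, Equiv.prodProdProdComm_apply, Prod.map_apply]
        ring
      · ext p
        simp only [Function.comp_apply, Equiv.prodProdProdComm_apply]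
        ring
    · refine (injOn_add_mul (K := 2 * K) (by linarith)).mono ?_
      rintro _ ⟨p, rfl⟩
      calc |a p.1.1 + s * a p.1.2| ≤ |a p.1.1| + |s * a p.1.2| := abs_add_le _ _
        _ ≤ 2 * K := by
          rw [abs_mul, hs, one_mul]
          linarith [hK p.1.1, hK p.1.2]
  refine ⟨ι × κ, inferInstance, fun p => a p.1 + (4 * K + 1) * b p.2, fun p => w p.1 * v p.2,
    fun p => mul_nonneg (hw0 _) (hv0 _), ?_, ?_⟩
  · rw [Fintype.sum_prod_type, ← Finset.sum_mul_sum, hw1, hv1, one_mul]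
  · have hadd := key 1 (by simp)
    have hsub := key (-1) (by simp)
    simp only [one_mul, neg_mul, ← sub_eq_add_neg] at hadd hsub
    unfold discEntGap
    rw [hadd, hsub]
    ring

lemma succ_mul_mem_discEntGaps {d : ℝ} (hd : d ∈ discEntGaps) (n : ℕ) :
    ((n : ℝ) + 1) * d ∈ discEntGaps := by
  induction n with
  | zero => simpa using hd
  | succ n ih =>
    have := add_mem_discEntGaps ih hd
    convert this using 1
    push_cast
    ring

lemma discEntGap_natCast_div {ι : Type*} [Fintype ι] (a : ι → ℤ) (n : ι → ℕ) (N : ℕ) (hN : N ≠ 0)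
    (hn : ∑ i, n i = N) :
    discEntGap a (fun i => (n i : ℝ) / N) =
      (Real.log (∏ k ∈ Finset.univ.image fun p : ι × ι => a p.1 - a p.2,
          pushWeight (fun p : ι × ι => a p.1 - a p.2) (fun p => n p.1 * n p.2) k ^
          pushWeight (fun p : ι × ι => a p.1 - a p.2) (fun p => n p.1 * n p.2) k : ℕ)
        - Real.log (∏ k ∈ Finset.univ.image fun p : ι × ι => a p.1 + a p.2,
          pushWeight (fun p : ι × ι => a p.1 + a p.2) (fun p => n p.1 * n p.2) k ^
          pushWeight (fun p : ι × ι => a p.1 + a p.2) (fun p => n p.1 * n p.2) k : ℕ))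
      / (N * N : ℕ) := by
  have hn2 : ∑ p : ι × ι, n p.1 * n p.2 = N * N := by
    rw [Fintype.sum_prod_type, ← Finset.sum_mul_sum, hn]
  have hw : (fun p : ι × ι => (n p.1 : ℝ) / N * ((n p.2 : ℝ) / N))
      = fun p => ((n p.1 * n p.2 : ℕ) : ℝ) / (N * N : ℕ) := by
    ext p
    push_cast
    rw [div_mul_div_comm]
  unfold discEntGap
  rw [hw, discEnt_natCast_div _ _ _ (mul_ne_zero hN hN) hn2,
    discEnt_natCast_div _ _ _ (mul_ne_zero hN hN) hn2]
  ring

lemma discEntGap_skew_pos :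
    0 < discEntGap ![0, 1, 2, 4, 5]
      (fun i => ((![1, 4, 1, 3, 3] : Fin 5 → ℕ) i : ℝ) / (12 : ℕ)) := by
  rw [discEntGap_natCast_div _ _ _ (by norm_num) (by decide)]
  refine div_pos (sub_pos.2 (Real.log_lt_log (Nat.cast_pos.2 ?_) (Nat.cast_lt.2 ?_))) (by norm_num)
  · exact Finset.prod_pos fun k _ => Nat.pow_self_pos
  · decide +kernel

lemma discEntGap_uniform_neg :
    discEntGap ![0, 1, 2, 4, 5]
      (fun i => ((![1, 1, 0, 1, 0] : Fin 5 → ℕ) i : ℝ) / (3 : ℕ)) < 0 := by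
  rw [discEntGap_natCast_div _ _ _ (by norm_num) (by decide)]
  refine div_neg_of_neg_of_pos
    (sub_neg.2 (Real.log_lt_log (Nat.cast_pos.2 ?_) (Nat.cast_lt.2 ?_))) (by norm_num)
  · exact Finset.prod_pos fun k _ => Nat.pow_self_pos
  · decide +kernel

lemma exists_Icc_subset_discEntGaps :
    ∃ c d : ℝ, c < 0 ∧ 0 < d ∧ Set.Icc c d ⊆ discEntGaps := by
  refine ⟨_, _, discEntGap_uniform_neg, discEntGap_skew_pos, ?_⟩
  set p : Fin 5 → ℝ := fun i => ((![1, 1, 0, 1, 0] : Fin 5 → ℕ) i : ℝ) / (3 : ℕ) with hp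
  set q : Fin 5 → ℝ := fun i => ((![1, 4, 1, 3, 3] : Fin 5 → ℕ) i : ℝ) / (12 : ℕ) with hq
  have hp0 (i : Fin 5) : 0 ≤ p i := by positivity
  have hq0 (i : Fin 5) : 0 ≤ q i := by positivity
  have hp1 : ∑ i, p i = 1 := by
    norm_num [hp, Fin.sum_univ_succ]
  have hq1 : ∑ i, q i = 1 := by
    norm_num [hq, Fin.sum_univ_succ]
  let w : ℝ → Fin 5 → ℝ := fun t i => (1 - t) * p i + t * q i
  have hcont : Continuous fun t => discEntGap ![0, 1, 2, 4, 5] (w t) := by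
    unfold discEntGap
    exact (continuous_discEnt _ fun i => by fun_prop).sub
      (continuous_discEnt _ fun i => by fun_prop)
  have hw0 : w 0 = p := by
    ext i
    simp [w]
  have hw1 : w 1 = q := by
    ext i
    simp [w]
  have hivt := intermediate_value_Icc zero_le_one hcont.continuousOn
  rw [hw0, hw1] at hivt
  intro x hx
  obtain ⟨t, ⟨ht0, ht1⟩, rfl⟩ := hivt hx
  refine ⟨Fin 5, inferInstance, _, w t, fun i => ?_, ?_, rfl⟩
  · exact add_nonneg (mul_nonneg (sub_nonneg.2 ht1) (hp0 i)) (mul_nonneg ht0 (hq0 i))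
  · simp only [w, Finset.sum_add_distrib, ← Finset.mul_sum, hp1, hq1]
    ring

lemma mem_discEntGaps (M : ℝ) : M ∈ discEntGaps := by
  obtain ⟨c, d, hc, hd, hsub⟩ := exists_Icc_subset_discEntGaps
  have htend : Filter.Tendsto (fun n : ℕ => M / ((n : ℝ) + 1)) Filter.atTop (nhds 0) :=
    tendsto_const_div_atTop_nhds_zero_nat M |>.comp (Filter.tendsto_add_atTop_nat 1) |>.congr
      fun n => by simp
  obtain ⟨n, hn⟩ := (htend.eventually (Icc_mem_nhds hc hd)).exists
  have hmem := succ_mul_mem_discEntGaps (hsub hn) n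
  rwa [mul_div_cancel₀ M (by positivity)] at hmem

/-- The law of `a + T`, where `T` has law `ν` and the independent variable `a` takes the value
`a i` with probability `w i`. -/
noncomputable def latticeMixture {ι : Type*} [Fintype ι] (a : ι → ℤ) (w : ι → ℝ)
    (ν : Measure ℝ) : Measure ℝ :=
  ∑ i, ENNReal.ofReal (w i) • ν.map (fun x => (a i : ℝ) + x)

section Mixture

open scoped ENNReal

variable {ι κ : Type*} [Fintype ι] [Fintype κ]

lemma lintegral_latticeMixture (a : ι → ℤ) (w : ι → ℝ) (ν : Measure ℝ) {f : ℝ → ℝ≥0∞}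
    (hf : Measurable f) :
    ∫⁻ x, f x ∂latticeMixture a w ν = ∑ i, ENNReal.ofReal (w i) * ∫⁻ x, f (a i + x) ∂ν := by
  unfold latticeMixture
  rw [lintegral_finsetSum_measure]
  refine Finset.sum_congr rfl fun i _ => ?_
  rw [lintegral_smul_measure, lintegral_map hf (by fun_prop), smul_eq_mul]

instance (a : ι → ℤ) (w : ι → ℝ) (ν : Measure ℝ) [IsFiniteMeasure ν] :
    IsFiniteMeasure (latticeMixture a w ν) := by
  refine ⟨?_⟩
  rw [← lintegral_one, lintegral_latticeMixture _ _ _ measurable_const]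
  simp [ENNReal.mul_lt_top_iff, measure_lt_top, ENNReal.sum_lt_top]

lemma isProbabilityMeasure_latticeMixture (a : ι → ℤ) {w : ι → ℝ} (ν : Measure ℝ)
    [IsProbabilityMeasure ν] (hw : ∀ i, 0 ≤ w i) (hw1 : ∑ i, w i = 1) :
    IsProbabilityMeasure (latticeMixture a w ν) := by
  refine ⟨?_⟩
  rw [← lintegral_one, lintegral_latticeMixture _ _ _ measurable_const]
  simp [← ENNReal.ofReal_sum_of_nonneg fun i _ => hw i, hw1]

lemma latticeMixture_conv (a : ι → ℤ) (b : κ → ℤ) {w : ι → ℝ} {v : κ → ℝ} (hw : ∀ i, 0 ≤ w i)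
    (ν ν' : Measure ℝ) [IsFiniteMeasure ν] [IsFiniteMeasure ν'] :
    (latticeMixture a w ν).conv (latticeMixture b v ν') =
      latticeMixture (fun p : ι × κ => a p.1 + b p.2) (fun p => w p.1 * v p.2) (ν.conv ν') := by
  refine Measure.ext_of_lintegral _ fun f hf => ?_
  rw [Measure.lintegral_conv hf, lintegral_latticeMixture _ _ _ (by fun_prop),
    lintegral_latticeMixture _ _ _ hf, Fintype.sum_prod_type]
  refine Finset.sum_congr rfl fun i _ => ?_
  have hinner (x : ℝ) : ∫⁻ y, f (a i + x + y) ∂latticeMixture b v ν'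
      = ∑ j, ENNReal.ofReal (v j) * ∫⁻ y, f (a i + x + (b j + y)) ∂ν' :=
    lintegral_latticeMixture _ _ _ (by fun_prop)
  simp_rw [hinner]
  rw [lintegral_finsetSum _ (fun j _ => by fun_prop), Finset.mul_sum]
  refine Finset.sum_congr rfl fun j _ => ?_
  rw [lintegral_const_mul _ (by fun_prop), Measure.lintegral_conv (by fun_prop),
    ENNReal.ofReal_mul (hw i), mul_assoc]
  push_cast
  simp_rw [add_assoc, add_left_comm _ (b j : ℝ)]

lemma map_neg_latticeMixture (a : ι → ℤ) (w : ι → ℝ) (ν : Measure ℝ) :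
    (latticeMixture a w ν).map (fun x => -x)
      = latticeMixture (fun i => -a i) w (ν.map fun x => -x) := by
  refine Measure.ext_of_lintegral _ fun f hf => ?_
  rw [lintegral_map hf (by fun_prop), lintegral_latticeMixture _ _ _ (by fun_prop),
    lintegral_latticeMixture _ _ _ hf]
  refine Finset.sum_congr rfl fun i _ => ?_
  rw [lintegral_map (by fun_prop) (by fun_prop)]
  push_cast
  simp_rw [neg_add]

lemma map_add_neg_prod (μ ν : Measure ℝ) [SFinite μ] [SFinite ν] :
    (μ.prod ν).map (fun z => z.1 + -z.2) = μ.conv (ν.map fun x => -x) := by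
  refine Measure.ext_of_lintegral _ fun f hf => ?_
  rw [lintegral_map hf (by fun_prop), lintegral_prod _ (by fun_prop), Measure.lintegral_conv hf]
  refine lintegral_congr fun x => ?_
  rw [lintegral_map (by fun_prop) (by fun_prop)]

lemma latticeMixture_withDensity (a : ι → ℤ) {w : ι → ℝ} (hw : ∀ i, 0 ≤ w i) {g : ℝ → ℝ}
    (hg : Measurable g) (hg0 : ∀ x, 0 ≤ g x) :
    latticeMixture a w (volume.withDensity fun x => ENNReal.ofReal (g x))
      = volume.withDensity fun x => ENNReal.ofReal (∑ i, w i * g (x - a i)) := by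
  refine Measure.ext_of_lintegral _ fun f hf => ?_
  rw [lintegral_latticeMixture _ _ _ hf,
    lintegral_withDensity_eq_lintegral_mul _ (by fun_prop) hf]
  simp_rw [Pi.mul_apply, ENNReal.ofReal_sum_of_nonneg fun i _ => mul_nonneg (hw i) (hg0 _),
    Finset.sum_mul]
  rw [lintegral_finsetSum _ (fun i _ => by fun_prop)]
  refine Finset.sum_congr rfl fun i _ => ?_
  rw [lintegral_withDensity_eq_lintegral_mul _ (by fun_prop) (by fun_prop),
    ← lintegral_add_left_eq_self (fun x => ENNReal.ofReal (w i * g (x - a i)) * f x) (a i : ℝ),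
    ← lintegral_const_mul _ (by fun_prop)]
  simp [ENNReal.ofReal_mul (hw i), mul_assoc]

end Mixture

/-- `g` is a bounded probability density supported in an interval of length less than one. -/
structure IsBumpDensity (g : ℝ → ℝ) : Prop where
  measurable : Measurable g
  nonneg : ∀ x, 0 ≤ g x
  bounded : ∃ C, ∀ x, g x ≤ C
  support : ∀ x, 1 / 4 < |x| → g x = 0
  isProbabilityMeasure : IsProbabilityMeasure (volume.withDensity fun x => ENNReal.ofReal (g x))

namespace IsBumpDensity

variable {g : ℝ → ℝ}

lemma integrable_comp (hg : IsBumpDensity g) {φ : ℝ → ℝ} (hφ : Continuous φ) (hφ0 : φ 0 = 0) :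
    Integrable (fun x => φ (g x)) := by
  obtain ⟨C, hC⟩ := hg.bounded
  obtain ⟨B, hB⟩ := isCompact_Icc.exists_bound_of_continuousOn (s := Set.Icc 0 C) hφ.continuousOn
  have hsupp : Function.support (fun x => φ (g x)) ⊆ Set.Icc (-(1 / 4)) (1 / 4) := by
    intro x hx
    by_contra hmem
    refine hx ?_
    simp only
    rw [hg.support x, hφ0]
    rw [lt_abs]
    by_contra! hle
    exact hmem ⟨by linarith, hle.1⟩
  rw [← integrableOn_iff_integrable_of_support_subset hsupp]
  exact Measure.integrableOn_of_bounded (by simp)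
    (hφ.measurable.comp hg.measurable).aestronglyMeasurable
    (Filter.Eventually.of_forall fun x => hB _ ⟨hg.nonneg x, hC x⟩)

lemma integrable (hg : IsBumpDensity g) : Integrable g :=
  hg.integrable_comp continuous_id rfl

lemma integral_eq_one (hg : IsBumpDensity g) : ∫ x, g x = 1 := by
  have h := hg.isProbabilityMeasure.measure_univ
  rw [withDensity_apply _ MeasurableSet.univ, Measure.restrict_univ,
    ← ofReal_integral_eq_lintegral_ofReal (hg.integrable)
      (Filter.Eventually.of_forall hg.nonneg)] at h
  simpa using h

lemma eq_zero_of_ne (hg : IsBumpDensity g) {k l : ℤ} (hkl : k ≠ l) {x : ℝ}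
    (hk : g (x - k) ≠ 0) : g (x - l) = 0 := by
  refine hg.support _ ?_
  have h1 : |x - k| ≤ 1 / 4 := not_lt.1 fun h => hk (hg.support _ h)
  have h2 : (1 : ℝ) ≤ |(k : ℝ) - l| := by exact_mod_cast Int.one_le_abs (sub_ne_zero.2 hkl)
  have h3 : |(k : ℝ) - l| ≤ |x - l| + |x - k| := by
    rw [show (k : ℝ) - l = (x - l) - (x - k) by ring]
    exact abs_sub _ _
  linarith

lemma negMulLog_sum (hg : IsBumpDensity g) (K : Finset ℤ) (s : ℤ → ℝ) (x : ℝ) :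
    Real.negMulLog (∑ k ∈ K, s k * g (x - k)) = ∑ k ∈ K, Real.negMulLog (s k * g (x - k)) := by
  by_cases h : ∃ k ∈ K, g (x - k) ≠ 0
  · obtain ⟨k, hk, hgk⟩ := h
    have hz (l : ℤ) (hl : l ≠ k) : g (x - l) = 0 := hg.eq_zero_of_ne hl.symm hgk
    rw [Finset.sum_eq_single_of_mem k hk fun l _ hl => by rw [hz l hl, mul_zero],
      Finset.sum_eq_single_of_mem k hk fun l _ hl => by rw [hz l hl, mul_zero,
        Real.negMulLog_zero]]
  · push Not at h
    rw [Finset.sum_eq_zero fun k hk => by rw [h k hk, mul_zero],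
      Finset.sum_eq_zero fun k hk => by rw [h k hk, mul_zero, Real.negMulLog_zero],
      Real.negMulLog_zero]

variable {ι : Type*} [Fintype ι] (a : ι → ℤ) (w : ι → ℝ)

lemma negMulLog_mixture (hg : IsBumpDensity g) (x : ℝ) :
    Real.negMulLog (∑ i, w i * g (x - a i)) = ∑ k ∈ Finset.univ.image a,
      (g (x - k) * Real.negMulLog (pushWeight a w k)
        + pushWeight a w k * Real.negMulLog (g (x - k))) := by
  rw [← sum_pushWeight_mul a w fun k => g (x - k), hg.negMulLog_sum]
  simp_rw [Real.negMulLog_mul]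

lemma integrable_mixture_term (hg : IsBumpDensity g) (k : ℤ) :
    Integrable (fun x : ℝ => g (x - k) * Real.negMulLog (pushWeight a w k)
      + pushWeight a w k * Real.negMulLog (g (x - k))) :=
  (((hg.integrable).comp_sub_right (k : ℝ)).mul_const _).add
    (((hg.integrable_comp Real.continuous_negMulLog Real.negMulLog_zero).comp_sub_right
      (k : ℝ)).const_mul _)

lemma integrable_negMulLog_mixture (hg : IsBumpDensity g) :
    Integrable (fun x => Real.negMulLog (∑ i, w i * g (x - a i))) := by
  simp_rw [hg.negMulLog_mixture a w]
  exact integrable_finsetSum _ fun k _ => hg.integrable_mixture_term a w k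

lemma integral_negMulLog_mixture (hg : IsBumpDensity g) (hw1 : ∑ i, w i = 1) :
    ∫ x, Real.negMulLog (∑ i, w i * g (x - a i))
      = discEnt a w + ∫ x, Real.negMulLog (g x) := by
  simp_rw [hg.negMulLog_mixture a w]
  rw [integral_finsetSum _ fun k _ => hg.integrable_mixture_term a w k]
  have hterm (k : ℤ) : ∫ x : ℝ, (g (x - k) * Real.negMulLog (pushWeight a w k)
      + pushWeight a w k * Real.negMulLog (g (x - k)))
      = Real.negMulLog (pushWeight a w k)
        + pushWeight a w k * ∫ x, Real.negMulLog (g x) := by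
    rw [integral_add
      (((hg.integrable).comp_sub_right (k : ℝ)).mul_const _)
      (((hg.integrable_comp Real.continuous_negMulLog Real.negMulLog_zero).comp_sub_right
        (k : ℝ)).const_mul _), integral_mul_const, integral_const_mul,
      integral_sub_right_eq_self (fun x => g x),
      integral_sub_right_eq_self (fun x => Real.negMulLog (g x)), hg.integral_eq_one, one_mul]
  simp_rw [hterm]
  rw [Finset.sum_add_distrib, ← Finset.sum_mul, sum_pushWeight, hw1, one_mul, discEnt]

end IsBumpDensity

section Law

variable {Ω : Type*} [MeasurableSpace Ω] {P : Measure Ω} {W : Ω → ℝ}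
  {ι : Type*} [Fintype ι] {a : ι → ℤ} {w : ι → ℝ} {g : ℝ → ℝ}

lemma hasPDF_of_map_eq_latticeMixture (hg : IsBumpDensity g) (hw : ∀ i, 0 ≤ w i)
    (hW : Measurable W)
    (hlaw : P.map W = latticeMixture a w (volume.withDensity fun x => ENNReal.ofReal (g x))) :
    HasPDF W P volume := by
  have hgm := hg.measurable
  rw [latticeMixture_withDensity a hw hg.measurable hg.nonneg] at hlaw
  exact hasPDF_of_map_eq_withDensity hW.aemeasurable _ (by fun_prop) hlaw

lemma negMulLog_pdf_ae_eq [IsFiniteMeasure P] (hg : IsBumpDensity g) (hw : ∀ i, 0 ≤ w i)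
    (hW : Measurable W)
    (hlaw : P.map W = latticeMixture a w (volume.withDensity fun x => ENNReal.ofReal (g x))) :
    (fun x => Real.negMulLog (pdf W P volume x).toReal)
      =ᵐ[volume] fun x => Real.negMulLog (∑ i, w i * g (x - a i)) := by
  have hgm := hg.measurable
  have := hasPDF_of_map_eq_latticeMixture hg hw hW hlaw
  rw [latticeMixture_withDensity a hw hg.measurable hg.nonneg] at hlaw
  filter_upwards [(pdf.eq_of_map_eq_withDensity _ (by fun_prop)).1 hlaw] with x hx
  rw [hx, ENNReal.toReal_ofReal (Finset.sum_nonneg fun i _ => mul_nonneg (hw i) (hg.nonneg _))]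

lemma diffEnt_eq_of_map_eq_latticeMixture [IsFiniteMeasure P] (hg : IsBumpDensity g)
    (hw : ∀ i, 0 ≤ w i) (hw1 : ∑ i, w i = 1) (hW : Measurable W)
    (hlaw : P.map W = latticeMixture a w (volume.withDensity fun x => ENNReal.ofReal (g x))) :
    diffEnt P W = discEnt a w + ∫ x, Real.negMulLog (g x) := by
  unfold diffEnt
  rw [integral_congr_ae (negMulLog_pdf_ae_eq hg hw hW hlaw),
    hg.integral_negMulLog_mixture a w hw1]

end Law

lemma exists_isBumpDensity (ν : Measure ℝ) [IsProbabilityMeasure ν] {C : ℝ} (hC : 0 ≤ C)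
    (hle : ν ≤ ENNReal.ofReal C • volume) (hsupp : ∀ᵐ x ∂ν, |x| ≤ 1 / 4) :
    ∃ g, IsBumpDensity g ∧ ν = volume.withDensity fun x => ENNReal.ofReal (g x) := by
  have hac : ν ≪ volume :=
    (Measure.absolutelyContinuous_of_le hle).trans Measure.smul_absolutelyContinuous
  let S : Set ℝ := {x | |x| ≤ 1 / 4}
  have hS : MeasurableSet S := measurableSet_le (by fun_prop) measurable_const
  have hρ : ν.rnDeriv volume ≤ᵐ[volume] fun _ => ENNReal.ofReal C := by
    refine ae_le_of_forall_setLIntegral_le_of_sigmaFinite (Measure.measurable_rnDeriv _ _)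
      fun s _ _ => ?_
    calc ∫⁻ x in s, ν.rnDeriv volume x ≤ ν s := Measure.setLIntegral_rnDeriv_le s
      _ ≤ (ENNReal.ofReal C • volume) s := hle s
      _ = ∫⁻ _ in s, ENNReal.ofReal C := by simp
  let g : ℝ → ℝ := S.indicator fun x => (min (ν.rnDeriv volume x) (ENNReal.ofReal C)).toReal
  have heq : ν = volume.withDensity fun x => ENNReal.ofReal (g x) := by
    calc ν = ν.restrict S := (Measure.restrict_eq_self_of_ae_mem hsupp).symm
      _ = volume.withDensity (S.indicator (ν.rnDeriv volume)) := by
        rw [withDensity_indicator hS, ← restrict_withDensity hS,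
          Measure.withDensity_rnDeriv_eq _ _ hac]
      _ = volume.withDensity fun x => ENNReal.ofReal (g x) := by
        refine withDensity_congr_ae ?_
        filter_upwards [hρ] with x hx
        by_cases hxS : x ∈ S
        · simp only [g, Set.indicator_of_mem hxS]
          rw [min_eq_left hx, ENNReal.ofReal_toReal (ne_top_of_le_ne_top ENNReal.ofReal_ne_top hx)]
        · simp [g, Set.indicator_of_notMem hxS]
  refine ⟨g, ⟨?_, ?_, ⟨C, fun x => ?_⟩, fun x hx => ?_, heq ▸ inferInstance⟩, heq⟩
  · exact ((Measure.measurable_rnDeriv _ _).min measurable_const).ennreal_toReal.indicator hS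
  · exact fun x => Set.indicator_nonneg (fun _ _ => ENNReal.toReal_nonneg) x
  · refine Set.indicator_apply_le' (fun _ => ?_) fun _ => hC
    exact ENNReal.toReal_le_of_le_ofReal hC (min_le_right _ _)
  · have hxS : x ∉ S := not_le.2 hx
    simp [g, hxS]

/-- The uniform distribution on `[-1/8, 1/8]`. -/
noncomputable def uniformNoise : Measure ℝ :=
  ENNReal.ofReal 4 • volume.restrict (Set.Icc (-(1 / 8)) (1 / 8))

instance : IsProbabilityMeasure uniformNoise := by
  refine ⟨?_⟩
  simp only [uniformNoise, Measure.smul_apply, Measure.restrict_apply_univ, Real.volume_Icc,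
    smul_eq_mul]
  rw [← ENNReal.ofReal_mul (by norm_num)]
  norm_num

lemma uniformNoise_le : uniformNoise ≤ ENNReal.ofReal 4 • volume := by
  unfold uniformNoise
  gcongr
  exact Measure.restrict_le_self

lemma ae_abs_le_uniformNoise : ∀ᵐ x ∂uniformNoise, |x| ≤ 1 / 8 := by
  refine Measure.smul_absolutelyContinuous.ae_le ?_
  filter_upwards [ae_restrict_mem measurableSet_Icc] with x hx using abs_le.2 hx

lemma map_neg_uniformNoise : uniformNoise.map (fun x => -x) = uniformNoise := by
  have h := (Measure.measurePreserving_neg (volume : Measure ℝ)).restrict_preimage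
    (measurableSet_Icc (a := (-(1 / 8) : ℝ)) (b := 1 / 8))
  unfold uniformNoise
  rw [Measure.map_smul]
  congr 1
  simpa using h.map_eq

lemma uniformNoise_conv_le : uniformNoise.conv uniformNoise ≤ ENNReal.ofReal 4 • volume := by
  refine Measure.le_iff.2 fun s hs => ?_
  rw [← lintegral_indicator_one hs, Measure.lintegral_conv (measurable_one.indicator hs)]
  calc ∫⁻ x, ∫⁻ y, s.indicator 1 (x + y) ∂uniformNoise ∂uniformNoise
      ≤ ∫⁻ _, (ENNReal.ofReal 4 • volume) s ∂uniformNoise := by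
        refine lintegral_mono fun x => ?_
        refine (lintegral_mono' uniformNoise_le le_rfl).trans_eq ?_
        rw [lintegral_smul_measure, lintegral_add_left_eq_self, lintegral_indicator_one hs]
        rfl
    _ = (ENNReal.ofReal 4 • volume) s := by simp

lemma ae_abs_le_uniformNoise_conv : ∀ᵐ x ∂uniformNoise.conv uniformNoise, |x| ≤ 1 / 4 := by
  unfold Measure.conv
  rw [ae_map_iff (by fun_prop) (measurableSet_le (by fun_prop) measurable_const)]
  have h1 : ∀ᵐ z ∂uniformNoise.prod uniformNoise, |z.1| ≤ 1 / 8 :=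
    Measure.quasiMeasurePreserving_fst.ae ae_abs_le_uniformNoise
  have h2 : ∀ᵐ z ∂uniformNoise.prod uniformNoise, |z.2| ≤ 1 / 8 :=
    Measure.quasiMeasurePreserving_snd.ae ae_abs_le_uniformNoise
  filter_upwards [h1, h2] with z hz1 hz2
  linarith [abs_add_le z.1 z.2]

/-- for every real `M` there exist i.i.d. real-valued random
variables `X, Y`, each having a density and finite differential entropy, such
that `h(X+Y) - h(X-Y) = M`. -/
theorem exists_iid_cont_diffEnt_add_sub_eq (M : ℝ) :
    ∃ (Ω : Type) (_ : MeasurableSpace Ω) (P : Measure Ω) (X Y : Ω → ℝ),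
      IsProbabilityMeasure P ∧ Measurable X ∧ Measurable Y ∧
      IndepFun X Y P ∧ IdentDistrib X Y P P ∧
      HasPDF X P volume ∧ HasPDF Y P volume ∧
      Integrable (fun x => Real.negMulLog ((MeasureTheory.pdf X P volume) x).toReal) volume ∧
      diffEnt P (fun ω => X ω + Y ω) - diffEnt P (fun ω => X ω - Y ω) = M := by
  obtain ⟨ι, _, a, w, hw, hw1, hgap⟩ := mem_discEntGaps M
  obtain ⟨g, hg, hνg⟩ := exists_isBumpDensity uniformNoise (by norm_num) uniformNoise_le
    (ae_abs_le_uniformNoise.mono fun x hx => hx.trans (by norm_num))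
  obtain ⟨τ, hτ, hντ⟩ := exists_isBumpDensity (uniformNoise.conv uniformNoise) (by norm_num)
    uniformNoise_conv_le ae_abs_le_uniformNoise_conv
  let μ := latticeMixture a w uniformNoise
  have : IsProbabilityMeasure μ := isProbabilityMeasure_latticeMixture a uniformNoise hw hw1
  have hX : (μ.prod μ).map Prod.fst = μ := by simp
  have hY : (μ.prod μ).map Prod.snd = μ := by simp
  have hlawX : (μ.prod μ).map Prod.fst
      = latticeMixture a w (volume.withDensity fun x => ENNReal.ofReal (g x)) := by
    rw [hX, ← hνg]
  have hlawY : (μ.prod μ).map Prod.snd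
      = latticeMixture a w (volume.withDensity fun x => ENNReal.ofReal (g x)) := by
    rw [hY, ← hνg]
  have hlawAdd : (μ.prod μ).map (fun z => z.1 + z.2)
      = latticeMixture (fun p : ι × ι => a p.1 + a p.2) (fun p => w p.1 * w p.2)
        (volume.withDensity fun x => ENNReal.ofReal (τ x)) := by
    rw [← hντ, ← latticeMixture_conv a a hw]
    rfl
  have hlawSub : (μ.prod μ).map (fun z => z.1 - z.2)
      = latticeMixture (fun p : ι × ι => a p.1 - a p.2) (fun p => w p.1 * w p.2)
        (volume.withDensity fun x => ENNReal.ofReal (τ x)) := by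
    have hneg : latticeMixture (fun i => -a i) w uniformNoise = μ.map (fun x => -x) := by
      rw [map_neg_latticeMixture, map_neg_uniformNoise]
    simp_rw [← hντ, sub_eq_add_neg]
    rw [← latticeMixture_conv a (fun i => -a i) hw, hneg]
    exact map_add_neg_prod μ μ
  have hww (p : ι × ι) : 0 ≤ w p.1 * w p.2 := mul_nonneg (hw _) (hw _)
  have hww1 : ∑ p : ι × ι, w p.1 * w p.2 = 1 := by
    rw [Fintype.sum_prod_type, ← Finset.sum_mul_sum, hw1, one_mul]
  refine ⟨ℝ × ℝ, inferInstance, μ.prod μ, Prod.fst, Prod.snd, inferInstance, measurable_fst,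
    measurable_snd, indepFun_prod measurable_id measurable_id,
    ⟨measurable_fst.aemeasurable, measurable_snd.aemeasurable, hX.trans hY.symm⟩,
    hasPDF_of_map_eq_latticeMixture hg hw measurable_fst hlawX,
    hasPDF_of_map_eq_latticeMixture hg hw measurable_snd hlawY,
    (hg.integrable_negMulLog_mixture a w).congr
      (negMulLog_pdf_ae_eq hg hw measurable_fst hlawX).symm, ?_⟩
  rw [diffEnt_eq_of_map_eq_latticeMixture hτ hww hww1 (by fun_prop) hlawAdd,
    diffEnt_eq_of_map_eq_latticeMixture hτ hww hww1 (by fun_prop) hlawSub, ← hgap, discEntGap]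
  ring
end

section
/- Let X and Y be independent, identically distributed random variables taking values in a countable abelian group, with finite Shannon entropy and H(X) > 0. Then 3/4 < H(X+Y)/H(X−Y) < 4/3. -/
open MeasureTheory ProbabilityTheory

open scoped ENNReal

namespace EntropyFreimanPigarev

/-- The surprisal `-log a` of a probability `a`, as an extended nonnegative real. -/
noncomputable def surprisal (a : ℝ≥0∞) : ℝ≥0∞ := ENNReal.ofReal (-Real.log a.toReal)

/-- The entropy of a mass function. -/
noncomputable def ent {ι : Type*} (p : ι → ℝ≥0∞) : ℝ≥0∞ := ∑' i, p i * surprisal (p i)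

@[simp]
lemma surprisal_one : surprisal 1 = 0 := by simp [surprisal]

lemma surprisal_mul {a b : ℝ≥0∞} (ha : a ≠ 0) (ha' : a ≤ 1) (hb : b ≠ 0) (hb' : b ≤ 1) :
    surprisal (a * b) = surprisal a + surprisal b := by
  have ha1 : a ≠ ∞ := ne_top_of_le_ne_top ENNReal.one_ne_top ha'
  have hb1 : b ≠ ∞ := ne_top_of_le_ne_top ENNReal.one_ne_top hb'
  have h1 : Real.log a.toReal ≤ 0 :=
    Real.log_nonpos ENNReal.toReal_nonneg (by simpa using ENNReal.toReal_mono ENNReal.one_ne_top ha')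
  have h2 : Real.log b.toReal ≤ 0 :=
    Real.log_nonpos ENNReal.toReal_nonneg (by simpa using ENNReal.toReal_mono ENNReal.one_ne_top hb')
  rw [surprisal, surprisal, surprisal, ← ENNReal.ofReal_add (by linarith) (by linarith),
    ENNReal.toReal_mul, Real.log_mul (ENNReal.toReal_ne_zero.2 ⟨ha, ha1⟩)
      (ENNReal.toReal_ne_zero.2 ⟨hb, hb1⟩)]
  congr 1
  ring

lemma surprisal_anti {a b : ℝ≥0∞} (ha : a ≠ 0) (hab : a ≤ b) (hb : b ≤ 1) :
    surprisal b ≤ surprisal a := by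
  have hb1 : b ≠ ∞ := ne_top_of_le_ne_top ENNReal.one_ne_top hb
  have ha1 : a ≠ ∞ := ne_top_of_le_ne_top hb1 hab
  exact ENNReal.ofReal_le_ofReal (neg_le_neg
    (Real.log_le_log (ENNReal.toReal_pos ha ha1) (ENNReal.toReal_mono hb1 hab)))

lemma surprisal_strictAnti {a b : ℝ≥0∞} (ha : a ≠ 0) (hab : a < b) (hb : b ≤ 1) :
    surprisal b < surprisal a := by
  have hb1 : b ≠ ∞ := ne_top_of_le_ne_top ENNReal.one_ne_top hb
  have ha1 : a ≠ ∞ := hab.ne_top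
  have h0 := ENNReal.toReal_pos ha ha1
  have h1 : a.toReal < b.toReal := ENNReal.toReal_strict_mono hb1 hab
  have h2 : b.toReal ≤ 1 := by simpa using ENNReal.toReal_mono ENNReal.one_ne_top hb
  refine (ENNReal.ofReal_lt_ofReal_iff ?_).2 (neg_lt_neg (Real.log_lt_log h0 h1))
  have := Real.log_neg h0 (h1.trans_le h2)
  linarith

lemma surprisal_add_one_le {a b : ℝ≥0∞} (ha : a ≠ 0) (ha' : a ≤ 1) (hb : b ≠ 0) (hb' : b ≤ 1) :
    surprisal a + 1 ≤ surprisal b + b / a := by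
  have ha1 : a ≠ ∞ := ne_top_of_le_ne_top ENNReal.one_ne_top ha'
  have hb1 : b ≠ ∞ := ne_top_of_le_ne_top ENNReal.one_ne_top hb'
  have pa := ENNReal.toReal_pos ha ha1
  have pb := ENNReal.toReal_pos hb hb1
  have h1 : Real.log a.toReal ≤ 0 :=
    Real.log_nonpos pa.le (by simpa using ENNReal.toReal_mono ENNReal.one_ne_top ha')
  have h2 : Real.log b.toReal ≤ 0 :=
    Real.log_nonpos pb.le (by simpa using ENNReal.toReal_mono ENNReal.one_ne_top hb')
  have h3 : b / a = ENNReal.ofReal (b.toReal / a.toReal) := by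
    rw [ENNReal.ofReal_div_of_pos pa, ENNReal.ofReal_toReal ha1, ENNReal.ofReal_toReal hb1]
  rw [h3, surprisal, surprisal, ← ENNReal.ofReal_one, ← ENNReal.ofReal_add (by linarith) zero_le_one,
    ← ENNReal.ofReal_add (by linarith) (by positivity)]
  apply ENNReal.ofReal_le_ofReal
  have := Real.log_le_sub_one_of_pos (div_pos pb pa)
  rw [Real.log_div pb.ne' pa.ne'] at this
  linarith

/-- Gibbs' inequality for an expectation of surprisals. -/
lemma tsum_surprisal_le {ι : Type*} {m a b : ι → ℝ≥0∞} (hm : ∑' i, m i = 1)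
    (ha : ∀ i, m i ≠ 0 → a i ≠ 0 ∧ a i ≤ 1) (hb : ∀ i, m i ≠ 0 → b i ≠ 0 ∧ b i ≤ 1)
    (hab : ∑' i, m i * (b i / a i) ≤ 1) :
    ∑' i, m i * surprisal (a i) ≤ ∑' i, m i * surprisal (b i) := by
  have key : ∑' i, m i * surprisal (a i) + 1 ≤ ∑' i, m i * surprisal (b i) + 1 :=
    calc ∑' i, m i * surprisal (a i) + 1
        = ∑' i, m i * (surprisal (a i) + 1) := by
          simp_rw [mul_add, mul_one, ENNReal.tsum_add, hm]
      _ ≤ ∑' i, m i * (surprisal (b i) + b i / a i) := by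
          refine ENNReal.tsum_le_tsum fun i => ?_
          by_cases h : m i = 0
          · simp [h]
          · exact mul_le_mul_right
              (surprisal_add_one_le (ha i h).1 (ha i h).2 (hb i h).1 (hb i h).2) _
      _ ≤ ∑' i, m i * surprisal (b i) + 1 := by
          simp_rw [mul_add, ENNReal.tsum_add]
          gcongr
  exact (ENNReal.add_le_add_iff_right ENNReal.one_ne_top).1 key

/-- Gibbs' inequality for expectations of sums of two surprisals. -/
lemma tsum_surprisal_add_le {ι : Type*} {m a a' b b' : ι → ℝ≥0∞} (hm : ∑' i, m i = 1)
    (ha : ∀ i, m i ≠ 0 → a i ≠ 0 ∧ a i ≤ 1) (ha' : ∀ i, m i ≠ 0 → a' i ≠ 0 ∧ a' i ≤ 1)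
    (hb : ∀ i, m i ≠ 0 → b i ≠ 0 ∧ b i ≤ 1) (hb' : ∀ i, m i ≠ 0 → b' i ≠ 0 ∧ b' i ≤ 1)
    (hab : ∑' i, m i * (b i * b' i / (a i * a' i)) ≤ 1) :
    ∑' i, m i * surprisal (a i) + ∑' i, m i * surprisal (a' i) ≤
      ∑' i, m i * surprisal (b i) + ∑' i, m i * surprisal (b' i) := by
  have split : ∀ f g : ι → ℝ≥0∞, (∀ i, m i ≠ 0 → f i ≠ 0 ∧ f i ≤ 1) →
      (∀ i, m i ≠ 0 → g i ≠ 0 ∧ g i ≤ 1) →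
      ∑' i, m i * surprisal (f i) + ∑' i, m i * surprisal (g i) =
        ∑' i, m i * surprisal (f i * g i) := by
    intro f g hf hg
    rw [← ENNReal.tsum_add]
    refine tsum_congr fun i => ?_
    by_cases h : m i = 0
    · simp [h]
    · rw [surprisal_mul (hf i h).1 (hf i h).2 (hg i h).1 (hg i h).2, mul_add]
  rw [split a a' ha ha', split b b' hb hb']
  exact tsum_surprisal_le hm
    (fun i h => ⟨mul_ne_zero (ha i h).1 (ha' i h).1, mul_le_one' (ha i h).2 (ha' i h).2⟩)
    (fun i h => ⟨mul_ne_zero (hb i h).1 (hb' i h).1, mul_le_one' (hb i h).2 (hb' i h).2⟩) hab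

lemma le_one_of_tsum_eq_one {ι : Type*} {p : ι → ℝ≥0∞} (hp : ∑' i, p i = 1) (i : ι) : p i ≤ 1 :=
  hp ▸ ENNReal.le_tsum i

lemma ne_top_of_tsum_eq_one {ι : Type*} {p : ι → ℝ≥0∞} (hp : ∑' i, p i = 1) (i : ι) : p i ≠ ∞ :=
  ne_top_of_le_ne_top ENNReal.one_ne_top (le_one_of_tsum_eq_one hp i)

lemma cancel_middle_le {b : ℝ≥0∞} (hb' : b ≠ ∞) (a c B w : ℝ≥0∞) :
    a * b * c * (B / (b * w)) ≤ a * c * (B / w) := by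
  by_cases hb : b = 0
  · simp [hb]
  rw [div_eq_mul_inv, div_eq_mul_inv, ENNReal.mul_inv (.inl hb) (.inl hb')]
  calc _ = b * b⁻¹ * (a * c * (B * w⁻¹)) := by ring
    _ ≤ _ := by rw [ENNReal.mul_inv_cancel hb hb', one_mul]

lemma tsum_mul_mul_eq_one {G : Type*} {u v r : G → ℝ≥0∞} (hu : ∑' x, u x = 1) (hv : ∑' x, v x = 1)
    (hr : ∑' x, r x = 1) : ∑' i : G × G × G, u i.1 * v i.2.1 * r i.2.2 = 1 := by
  simp [ENNReal.tsum_prod', mul_assoc, ENNReal.tsum_mul_left, hu, hv, hr]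

lemma tsum_triple_middle {G : Type*} {u v r : G → ℝ≥0∞} (hu : ∑' x, u x = 1) (hr : ∑' x, r x = 1)
    (F : G → ℝ≥0∞) :
    ∑' i : G × G × G, u i.1 * v i.2.1 * r i.2.2 * F i.2.1 = ∑' y, v y * F y := by
  simp_rw [ENNReal.tsum_prod', mul_right_comm _ (r _), mul_assoc, ENNReal.tsum_mul_left,
    ENNReal.tsum_mul_right, hr, hu, mul_one, one_mul]

section Conv

variable {G : Type*} [AddCommGroup G]

/-- The convolution of two mass functions: the law of an independent sum. -/
noncomputable def conv (u v : G → ℝ≥0∞) (t : G) : ℝ≥0∞ := ∑' x, u x * v (t - x)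

lemma tsum_conv_mul (u v F : G → ℝ≥0∞) :
    ∑' t, conv u v t * F t = ∑' x, ∑' y, u x * v y * F (x + y) := by
  simp_rw [conv, ← ENNReal.tsum_mul_right]
  rw [ENNReal.tsum_comm]
  refine tsum_congr fun x => ?_
  rw [← (Equiv.addLeft x).tsum_eq]
  simp

lemma tsum_conv {u v : G → ℝ≥0∞} (hu : ∑' x, u x = 1) (hv : ∑' x, v x = 1) :
    ∑' t, conv u v t = 1 := by
  have := tsum_conv_mul u v 1
  simpa [ENNReal.tsum_mul_left, ENNReal.tsum_mul_right, hu, hv] using this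

lemma conv_assoc (u v w : G → ℝ≥0∞) : conv (conv u v) w = conv u (conv v w) := by
  ext t
  rw [conv, tsum_conv_mul u v fun r => w (t - r)]
  simp_rw [conv, ← ENNReal.tsum_mul_left, mul_assoc, sub_sub]

lemma conv_comm (u v : G → ℝ≥0∞) : conv u v = conv v u := by
  ext t
  rw [conv, ← (Equiv.subLeft t).tsum_eq]
  simp [conv, mul_comm]

lemma mul_le_conv (u v : G → ℝ≥0∞) (x y : G) : u x * v y ≤ conv u v (x + y) := by
  simpa [conv] using ENNReal.le_tsum (f := fun z => u z * v (x + y - z)) x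

lemma ent_comp_neg (u : G → ℝ≥0∞) : ent (fun x => u (-x)) = ent u :=
  tsum_comp_neg fun x => u x * surprisal (u x)

lemma ent_le_ent_conv {u v : G → ℝ≥0∞} (hu : ∑' x, u x = 1) (hv : ∑' x, v x = 1) :
    ent u ≤ ent (conv u v) := by
  have hm : ∑' i : G × G, u i.1 * v i.2 = 1 := by
    simp [ENNReal.tsum_prod', ENNReal.tsum_mul_left, hu, hv]
  have hc := tsum_conv hu hv
  have key := tsum_surprisal_le (m := fun i : G × G => u i.1 * v i.2) (a := fun i => u i.1)
    (b := fun i => conv u v (i.1 + i.2)) hm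
    (fun i h => ⟨left_ne_zero_of_mul h, le_one_of_tsum_eq_one hu _⟩)
    (fun i h => ⟨fun h0 => h (le_zero_iff.1 (h0 ▸ mul_le_conv u v _ _)),
      le_one_of_tsum_eq_one hc _⟩) ?_
  · convert key using 1
    · simp_rw [ENNReal.tsum_prod', mul_right_comm _ (v _), ENNReal.tsum_mul_left, hv, mul_one, ent]
    · rw [ent, tsum_conv_mul u v fun t => surprisal (conv u v t), ENNReal.tsum_prod']
  · calc ∑' i : G × G, u i.1 * v i.2 * (conv u v (i.1 + i.2) / u i.1)
        ≤ ∑' i : G × G, v i.2 * conv u v (i.1 + i.2) := by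
          refine ENNReal.tsum_le_tsum fun i => ?_
          calc _ = u i.1 / u i.1 * (v i.2 * conv u v (i.1 + i.2)) := by
                simp only [div_eq_mul_inv]; ring
            _ ≤ _ := mul_le_of_le_one_left' ENNReal.div_self_le_one
      _ = 1 := by
          rw [ENNReal.tsum_prod', ENNReal.tsum_comm]
          have : ∀ y, ∑' x, conv u v (x + y) = 1 := fun y => by
            rw [← hc]; exact (Equiv.addRight y).tsum_eq (conv u v)
          simp_rw [ENNReal.tsum_mul_left, this, mul_one, hv]

/-- Strict subadditivity when the sum does not determine the summands. -/
lemma ent_conv_lt {u v : G → ℝ≥0∞} (hu : ∑' x, u x = 1) (hv : ∑' x, v x = 1)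
    (hu' : ent u ≠ ∞) (hv' : ent v ≠ ∞) {x y x' y' : G} (hx : u x ≠ 0) (hy : v y ≠ 0)
    (hx' : u x' ≠ 0) (hy' : v y' ≠ 0) (hne : x ≠ x') (hsum : x + y = x' + y') :
    ent (conv u v) < ent u + ent v := by
  have hc := tsum_conv hu hv
  have e1 : ent (conv u v) = ∑' i : G × G, u i.1 * v i.2 * surprisal (conv u v (i.1 + i.2)) := by
    rw [ent, tsum_conv_mul u v fun t => surprisal (conv u v t), ENNReal.tsum_prod']
  have e2 : ent u + ent v = ∑' i : G × G, u i.1 * v i.2 * (surprisal (u i.1) + surprisal (v i.2)) := by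
    simp_rw [mul_add, ENNReal.tsum_add, ENNReal.tsum_prod']
    congr 1
    · simp_rw [mul_right_comm _ (v _), ENNReal.tsum_mul_left, hv, mul_one, ent]
    · simp_rw [mul_assoc, ENNReal.tsum_mul_left, ENNReal.tsum_mul_right, hu, one_mul, ent]
  have le : ∀ i : G × G, u i.1 * v i.2 * surprisal (conv u v (i.1 + i.2)) ≤
      u i.1 * v i.2 * (surprisal (u i.1) + surprisal (v i.2)) := by
    intro i
    by_cases h : u i.1 * v i.2 = 0
    · simp [h]
    · rw [← surprisal_mul (left_ne_zero_of_mul h) (le_one_of_tsum_eq_one hu _)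
        (right_ne_zero_of_mul h) (le_one_of_tsum_eq_one hv _)]
      exact mul_le_mul_right (surprisal_anti h (mul_le_conv _ _ _ _) (le_one_of_tsum_eq_one hc _)) _
  have fin : ent (conv u v) ≠ ∞ :=
    ne_top_of_le_ne_top (ENNReal.add_ne_top.2 ⟨hu', hv'⟩)
      (by rw [e1, e2]; exact ENNReal.tsum_le_tsum le)
  have hxy : u x * v y ≠ 0 := mul_ne_zero hx hy
  have htop : u x * v y ≠ ∞ := ENNReal.mul_ne_top (ne_top_of_tsum_eq_one hu x) (ne_top_of_tsum_eq_one hv y)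
  have lt : u x * v y < conv u v (x + y) := by
    classical
    calc u x * v y < u x * v y + u x' * v y' :=
          ENNReal.lt_add_right htop (mul_ne_zero hx' hy')
      _ = ∑ z ∈ {x, x'}, u z * v (x + y - z) := by
          rw [Finset.sum_pair hne, add_sub_cancel_left, hsum, add_sub_cancel_left]
      _ ≤ conv u v (x + y) := ENNReal.sum_le_tsum _
  rw [e1] at fin ⊢
  rw [e2]
  refine ENNReal.tsum_lt_tsum (i := (x, y)) fin le ?_
  rw [← surprisal_mul hx (le_one_of_tsum_eq_one hu _) hy (le_one_of_tsum_eq_one hv _)]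
  exact ENNReal.mul_lt_mul_right hxy htop
    (surprisal_strictAnti hxy lt (le_one_of_tsum_eq_one hc _))

lemma tsum_triple_left {u v r : G → ℝ≥0∞} (hr : ∑' x, r x = 1) (F : G → ℝ≥0∞) :
    ∑' i : G × G × G, u i.1 * v i.2.1 * r i.2.2 * F (i.1 + i.2.1) = ∑' t, conv u v t * F t := by
  simp_rw [tsum_conv_mul, ENNReal.tsum_prod', mul_right_comm _ (r _), ENNReal.tsum_mul_left, hr,
    mul_one]

lemma tsum_triple_right {u v r : G → ℝ≥0∞} (hu : ∑' x, u x = 1) (F : G → ℝ≥0∞) :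
    ∑' i : G × G × G, u i.1 * v i.2.1 * r i.2.2 * F (i.2.1 + i.2.2) = ∑' t, conv v r t * F t := by
  simp_rw [tsum_conv_mul, ENNReal.tsum_prod', mul_assoc, ENNReal.tsum_mul_left,
    ENNReal.tsum_mul_right, hu, one_mul]

/-- Entropic submodularity for sums of three independent variables. -/
lemma ent_add_ent_conv_conv_le {u v r : G → ℝ≥0∞} (hu : ∑' x, u x = 1) (hv : ∑' x, v x = 1)
    (hr : ∑' x, r x = 1) :
    ent v + ent (conv u (conv v r)) ≤ ent (conv u v) + ent (conv v r) := by
  have huv := tsum_conv hu hv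
  have hvr := tsum_conv hv hr
  have hw := tsum_conv hu hvr
  have key := tsum_surprisal_add_le (m := fun i : G × G × G => u i.1 * v i.2.1 * r i.2.2)
    (a := fun i => v i.2.1) (a' := fun i => conv u (conv v r) (i.1 + (i.2.1 + i.2.2)))
    (b := fun i => conv u v (i.1 + i.2.1)) (b' := fun i => conv v r (i.2.1 + i.2.2))
    (tsum_mul_mul_eq_one hu hv hr)
    (fun i h => ⟨right_ne_zero_of_mul (left_ne_zero_of_mul h), le_one_of_tsum_eq_one hv _⟩)
    (fun i h => ⟨fun h0 => h (le_zero_iff.1 ?_), le_one_of_tsum_eq_one hw _⟩)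
    (fun i h => ⟨fun h0 => left_ne_zero_of_mul h (le_zero_iff.1 (h0 ▸ mul_le_conv u v _ _)),
      le_one_of_tsum_eq_one huv _⟩)
    (fun i h => ⟨fun h0 => mul_ne_zero (right_ne_zero_of_mul (left_ne_zero_of_mul h))
      (right_ne_zero_of_mul h) (le_zero_iff.1 (h0 ▸ mul_le_conv v r _ _)),
      le_one_of_tsum_eq_one hvr _⟩) ?_
  · rw [tsum_triple_middle hu hr fun y => surprisal (v y),
      tsum_triple_left hr fun t => surprisal (conv u v t),
      tsum_triple_right hu fun t => surprisal (conv v r t)] at key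
    refine le_trans (add_le_add le_rfl (le_of_eq ?_)) key
    rw [ent, tsum_conv_mul u (conv v r) fun t => surprisal (conv u (conv v r) t),
      ENNReal.tsum_prod']
    refine tsum_congr fun x => ?_
    simp_rw [mul_assoc, ENNReal.tsum_mul_left,
      tsum_conv_mul v r fun t => surprisal (conv u (conv v r) (x + t)), ENNReal.tsum_prod',
      mul_assoc]
  · rw [← h0, mul_assoc]
    exact (mul_le_mul_right (mul_le_conv v r _ _) _).trans (mul_le_conv u (conv v r) _ _)
  · calc _ ≤ ∑' i : G × G × G, u i.1 * r i.2.2 * (conv u v (i.1 + i.2.1) *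
          conv v r (i.2.1 + i.2.2) / conv u (conv v r) (i.1 + (i.2.1 + i.2.2))) :=
          ENNReal.tsum_le_tsum fun i => cancel_middle_le (ne_top_of_tsum_eq_one hv _) _ _ _ _
      _ = ∑' x, ∑' z, ∑' t, u x * r z * (conv u v (t - z) * conv v r (t - x) /
            conv u (conv v r) t) := by
          simp_rw [ENNReal.tsum_prod']
          refine tsum_congr fun x => ?_
          rw [ENNReal.tsum_comm]
          refine tsum_congr fun z => ?_
          symm
          rw [← (Equiv.addRight (x + z)).tsum_eq]
          refine tsum_congr fun y => ?_
          have h1 : y + (x + z) - z = x + y := by abel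
          have h2 : y + (x + z) - x = y + z := by abel
          have h3 : y + (x + z) = x + (y + z) := by abel
          simp only [Equiv.coe_addRight]
          rw [h1, h2, h3]
      _ = ∑' t, (∑' x, u x * conv v r (t - x)) * (∑' z, r z * conv u v (t - z)) /
            conv u (conv v r) t := by
          simp_rw [div_eq_mul_inv, ← ENNReal.tsum_mul_left, ← ENNReal.tsum_mul_right]
          calc _ = ∑' x, ∑' t, ∑' z, u x * r z * (conv u v (t - z) * conv v r (t - x) *
                  (conv u (conv v r) t)⁻¹) := tsum_congr fun x => ENNReal.tsum_comm
            _ = ∑' t, ∑' x, ∑' z, u x * r z * (conv u v (t - z) * conv v r (t - x) *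
                  (conv u (conv v r) t)⁻¹) := ENNReal.tsum_comm
            _ = _ := by
              refine tsum_congr fun t => ?_
              rw [ENNReal.tsum_comm]
              refine tsum_congr fun z => tsum_congr fun x => ?_
              ring
      _ ≤ ∑' t, conv u (conv v r) t := by
          refine ENNReal.tsum_le_tsum fun t => ?_
          change conv u (conv v r) t * conv r (conv u v) t / conv u (conv v r) t ≤ _
          rw [conv_comm r, conv_assoc, mul_div_assoc]
          exact mul_le_of_le_one_right' ENNReal.div_self_le_one
      _ ≤ 1 := hw.le

/-- The entropic Ruzsa triangle inequality. -/
lemma ent_add_ent_conv_neg_le {u v r : G → ℝ≥0∞} (hu : ∑' x, u x = 1) (hv : ∑' x, v x = 1)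
    (hr : ∑' x, r x = 1) :
    ent v + ent (conv u fun x => r (-x)) ≤ ent (conv u v) + ent (conv v r) := by
  have hr' : ∑' x, r (-x) = 1 := by rw [tsum_comp_neg, hr]
  have huv := tsum_conv hu hv
  have hvr := tsum_conv hv hr
  have hd := tsum_conv hu hr'
  set d := conv u fun x => r (-x) with hd_def
  have le_d : ∀ x z, u x * r z ≤ d (x - z) := fun x z => by
    simpa [sub_eq_add_neg] using mul_le_conv u (fun x => r (-x)) x (-z)
  have key := tsum_surprisal_add_le (m := fun i : G × G × G => u i.1 * v i.2.1 * r i.2.2)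
    (a := fun i => v i.2.1) (a' := fun i => d (i.1 - i.2.2))
    (b := fun i => conv u v (i.1 + i.2.1)) (b' := fun i => conv v r (i.2.1 + i.2.2))
    (tsum_mul_mul_eq_one hu hv hr)
    (fun i h => ⟨right_ne_zero_of_mul (left_ne_zero_of_mul h), le_one_of_tsum_eq_one hv _⟩)
    (fun i h => ⟨fun h0 => mul_ne_zero (left_ne_zero_of_mul (left_ne_zero_of_mul h))
      (right_ne_zero_of_mul h) (le_zero_iff.1 (h0 ▸ le_d _ _)), le_one_of_tsum_eq_one hd _⟩)
    (fun i h => ⟨fun h0 => left_ne_zero_of_mul h (le_zero_iff.1 (h0 ▸ mul_le_conv u v _ _)),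
      le_one_of_tsum_eq_one huv _⟩)
    (fun i h => ⟨fun h0 => mul_ne_zero (right_ne_zero_of_mul (left_ne_zero_of_mul h))
      (right_ne_zero_of_mul h) (le_zero_iff.1 (h0 ▸ mul_le_conv v r _ _)),
      le_one_of_tsum_eq_one hvr _⟩) ?_
  · rw [tsum_triple_middle hu hr fun y => surprisal (v y),
      tsum_triple_left hr fun t => surprisal (conv u v t),
      tsum_triple_right hu fun t => surprisal (conv v r t)] at key
    refine le_trans (add_le_add le_rfl (le_of_eq ?_)) key
    rw [ent, hd_def, tsum_conv_mul u _ fun t => surprisal (d t), ENNReal.tsum_prod']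
    refine tsum_congr fun x => ?_
    rw [ENNReal.tsum_prod', ENNReal.tsum_comm, ← tsum_comp_neg]
    refine tsum_congr fun z => ?_
    simp_rw [mul_right_comm _ (v _), ENNReal.tsum_mul_left, hv]
    simp [sub_eq_add_neg, ← hd_def]
  · calc _ ≤ ∑' i : G × G × G, u i.1 * r i.2.2 * (conv u v (i.1 + i.2.1) *
          conv v r (i.2.1 + i.2.2) / d (i.1 - i.2.2)) :=
          ENNReal.tsum_le_tsum fun i => cancel_middle_le (ne_top_of_tsum_eq_one hv _) _ _ _ _
      _ = ∑' x, ∑' z, u x * r z * (∑' t, conv u v t * conv v r (t - (x - z))) / d (x - z) := by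
          simp_rw [ENNReal.tsum_prod']
          refine tsum_congr fun x => ?_
          rw [ENNReal.tsum_comm]
          refine tsum_congr fun z => ?_
          simp_rw [div_eq_mul_inv, ← ENNReal.tsum_mul_left, ← ENNReal.tsum_mul_right]
          symm
          rw [← (Equiv.addLeft x).tsum_eq]
          refine tsum_congr fun y => ?_
          have h1 : x + y - (x - z) = y + z := by abel
          simp only [Equiv.coe_addLeft, h1]
          ring
      _ = ∑' c, d c * ((∑' t, conv u v t * conv v r (t - c)) / d c) := by
          rw [hd_def, tsum_conv_mul u _ fun c => (∑' t, conv u v t * conv v r (t - c)) / d c]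
          refine tsum_congr fun x => ?_
          rw [← tsum_comp_neg]
          simp [sub_eq_add_neg, mul_div_assoc, ← hd_def]
      _ ≤ ∑' c, ∑' t, conv u v t * conv v r (t - c) := by
          refine ENNReal.tsum_le_tsum fun c => ?_
          exact ENNReal.mul_div_le
      _ = 1 := by
          rw [ENNReal.tsum_comm]
          have : ∀ t, ∑' c, conv v r (t - c) = 1 := fun t => by
            rw [← hvr]; exact (Equiv.subLeft t).tsum_eq (conv v r)
          simp_rw [ENNReal.tsum_mul_left, this, mul_one, huv]

end Conv

/-- The mass function of `X`. -/
def law {Ω S : Type*} [MeasurableSpace Ω] (P : Measure Ω) (X : Ω → S) (s : S) : ℝ≥0∞ :=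
  P (X ⁻¹' {s})

section Law

variable {Ω G : Type*} [MeasurableSpace Ω] {P : Measure Ω}

lemma law_mul_surprisal [IsProbabilityMeasure P] (X : Ω → G) (s : G) :
    law P X s * surprisal (law P X s) = ENNReal.ofReal (Real.negMulLog (P (X ⁻¹' {s})).toReal) := by
  rw [surprisal, Real.negMulLog, neg_mul_comm, ENNReal.ofReal_mul ENNReal.toReal_nonneg,
    ENNReal.ofReal_toReal (measure_ne_top _ _), law]

lemma shEnt_eq_toReal_ent [IsProbabilityMeasure P] (X : Ω → G) : shEnt P X = (ent (law P X)).toReal := by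
  rw [shEnt, ent, ENNReal.tsum_toReal_eq fun s => by simp [law_mul_surprisal]]
  refine tsum_congr fun s => ?_
  rw [law_mul_surprisal, ENNReal.toReal_ofReal]
  exact Real.negMulLog_nonneg ENNReal.toReal_nonneg
    (by simpa using ENNReal.toReal_mono ENNReal.one_ne_top (prob_le_one (μ := P)))

lemma law_neg [AddCommGroup G] (X : Ω → G) : law P (fun ω => -X ω) = fun x => law P X (-x) := by
  ext x
  rw [law, law]
  congr 1
  ext ω
  simp [neg_eq_iff_eq_neg]

variable [Countable G] [MeasurableSpace G] [MeasurableSingletonClass G]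

lemma tsum_law [IsProbabilityMeasure P] {X : Ω → G} (hX : Measurable X) : ∑' s, law P X s = 1 := by
  have := tsum_measure_preimage_singleton (μ := P) (f := X) Set.countable_univ
    (fun y _ => hX (measurableSet_singleton y))
  rw [tsum_univ fun s => P (X ⁻¹' {s})] at this
  simpa [law] using this

lemma law_add [AddCommGroup G] {X Y : Ω → G} (hX : Measurable X) (hY : Measurable Y) (h : IndepFun X Y P) :
    law P (fun ω => X ω + Y ω) = conv (law P X) (law P Y) := by
  ext t
  have hU : (fun ω => X ω + Y ω) ⁻¹' {t} = ⋃ x, X ⁻¹' {x} ∩ Y ⁻¹' {t - x} := by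
    ext ω
    simp [eq_sub_iff_add_eq']
  rw [law, hU, measure_iUnion]
  · exact tsum_congr fun x =>
      h.measure_inter_preimage_eq_mul _ _ (measurableSet_singleton _) (measurableSet_singleton _)
  · intro x y hxy
    refine Set.disjoint_left.2 fun ω hω hω' => hxy ?_
    exact hω.1.symm.trans hω'.1
  · exact fun x => (hX (measurableSet_singleton _)).inter (hY (measurableSet_singleton _))

end Law

lemma exists_ne_of_ent_ne_zero {ι : Type*} {p : ι → ℝ≥0∞} (hp : ∑' i, p i = 1)
    (h : ent p ≠ 0) : ∃ x y, x ≠ y ∧ p x ≠ 0 ∧ p y ≠ 0 := by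
  obtain ⟨x, hx⟩ : ∃ x, p x * surprisal (p x) ≠ 0 := by
    by_contra! h0
    exact h (ENNReal.tsum_eq_zero.2 h0)
  by_contra! h0
  have h1 : p x = 1 := by
    rw [← hp, tsum_eq_single x fun y hy => h0 x y hy.symm (left_ne_zero_of_mul hx)]
  simp [h1] at hx

end EntropyFreimanPigarev

open EntropyFreimanPigarev

/-- entropy analogue of the Freiman–Pigarev inequality: for
i.i.d. random variables `X, Y` taking values in a countable abelian group, with
finite entropy and `H(X) > 0`, we have `3/4 < H(X+Y)/H(X-Y) < 4/3`. -/
theorem entropy_freiman_pigarev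
    {Ω G : Type*} [MeasurableSpace Ω] [AddCommGroup G] [Countable G]
    [MeasurableSpace G] [MeasurableSingletonClass G]
    (P : Measure Ω) [IsProbabilityMeasure P]
    (X Y : Ω → G) (hX : Measurable X) (hY : Measurable Y)
    (hindep : IndepFun X Y P) (hid : IdentDistrib X Y P P)
    (hfinEnt : Summable fun g : G => Real.negMulLog (P (X ⁻¹' {g})).toReal)
    (hpos : 0 < shEnt P X) :
    3 / 4 < shEnt P (fun ω => X ω + Y ω) / shEnt P (fun ω => X ω - Y ω) ∧
    shEnt P (fun ω => X ω + Y ω) / shEnt P (fun ω => X ω - Y ω) < 4 / 3 := by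
  have hp := tsum_law (P := P) hX
  have hlaw : law P Y = law P X :=
    funext fun s => (hid.measure_mem_eq (measurableSet_singleton s)).symm
  have hS : law P (fun ω => X ω + Y ω) = conv (law P X) (law P X) := by
    rw [law_add hX hY hindep, hlaw]
  have hD : law P (fun ω => X ω - Y ω) = conv (law P X) fun x => law P X (-x) := by
    have hneg : Measurable fun g : G => -g := measurable_of_countable _
    simp_rw [sub_eq_add_neg]
    rw [law_add (Y := fun ω => -Y ω) hX (hneg.comp hY) (hindep.comp measurable_id hneg), law_neg,
      hlaw]
  have hfin : ent (law P X) ≠ ∞ := by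
    simp_rw [ent, law_mul_surprisal]
    exact hfinEnt.tsum_ofReal_ne_top
  rw [shEnt_eq_toReal_ent] at hpos
  rw [shEnt_eq_toReal_ent, shEnt_eq_toReal_ent, hS, hD]
  generalize law P X = p at *
  have hp' : ∑' x, p (-x) = 1 := by rw [tsum_comp_neg, hp]
  have hfin' : ent (fun x => p (-x)) ≠ ∞ := by rwa [ent_comp_neg]
  obtain ⟨x, y, hxy, hx, hy⟩ :=
    exists_ne_of_ent_ne_zero hp (ENNReal.toReal_pos_iff.1 hpos).1.ne'
  have sum_lt : ent (conv p p) < ent p + ent p :=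
    ent_conv_lt hp hp hfin hfin hx hy hy hx hxy (add_comm x y)
  have diff_lt : ent (conv p fun x => p (-x)) < ent p + ent p := by
    have := ent_conv_lt hp hp' hfin hfin' (x := x) (y := -x) (x' := y) (y' := -y)
      hx (by simpa) hy (by simpa) hxy (by simp)
    rwa [ent_comp_neg] at this
  have diff_le : ent p + ent (conv p fun x => p (-x)) ≤ ent (conv p p) + ent (conv p p) :=
    ent_add_ent_conv_neg_le hp hp hp
  have sum_le : ent p + ent (conv p p) ≤
      ent (conv p fun x => p (-x)) + ent (conv p fun x => p (-x)) := by
    have h1 := ent_add_ent_conv_conv_le hp hp' hp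
    have h2 := ent_le_ent_conv (tsum_conv hp hp) hp'
    rw [conv_comm _ p, ent_comp_neg, ← conv_assoc] at h1
    exact (add_le_add_right h2 _).trans h1
  have le_diff := ent_le_ent_conv hp hp'
  have sum_fin := sum_lt.ne_top
  have diff_fin := diff_lt.ne_top
  generalize ent (conv p p) = S at *
  generalize ent (conv p fun x => p (-x)) = D at *
  generalize ent p = H at *
  lift S to NNReal using sum_fin
  lift D to NNReal using diff_fin
  lift H to NNReal using hfin
  norm_cast at sum_lt diff_lt diff_le sum_le le_diff
  simp only [ENNReal.coe_toReal] at hpos ⊢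
  have sum_lt : (S : ℝ) < H + H := mod_cast sum_lt
  have diff_lt : (D : ℝ) < H + H := mod_cast diff_lt
  have diff_le : (H : ℝ) + D ≤ S + S := mod_cast diff_le
  have sum_le : (H : ℝ) + S ≤ D + D := mod_cast sum_le
  have le_diff : (H : ℝ) ≤ D := mod_cast le_diff
  have hDpos : (0 : ℝ) < D := hpos.trans_le le_diff
  rw [lt_div_iff₀ hDpos, div_lt_iff₀ hDpos]
  constructor <;> linarith
end
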